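/- There exists ε₀ > 0 such that for every ε ∈ (0, ε₀) and every δ > 0 there exists R > 0 with the following property: every z ∈ ℂ with Im z ≥ R, Re z ≥ 0 and m(z) = ε (i.e. z lies on the level line ‖(𝒫 − z)^{−1}‖ = 1/ε) satisfies |Re z − (9/4)^{2/3}·(Im z)^{4/9}·(ln((Im z)^{4/9}/ε))^{2/3}| ≤ δ·(Im z)^{4/9}·(ln Im z)^{2/3}. In particular, along the level line, Re z = (1 + o(1))·(Im z)^{4/9}·(ln Im z)^{2/3} as Im z → ∞. -/

import Mathlib

open Complex MeasureTheory

/-- `mP z` is the infimum of `‖𝒫u − zu‖_{L²}/‖u‖_{L²}` over nonzero Schwartz functions,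
where `𝒫 = Dₓ² + ix³` is the cubic non-self-adjoint operator; `1/mP z = ‖(𝒫 − z)^{-1}‖`. -/
noncomputable def mP (z : ℂ) : ℝ :=
  sInf {r : ℝ | ∃ u : SchwartzMap ℝ ℂ, u ≠ 0 ∧
    r = (eLpNorm (fun x : ℝ =>
          -(deriv (deriv ⇑u) x) + Complex.I * (x:ℂ) ^ 3 * u x - z * u x) 2 volume).toReal
        / (eLpNorm (⇑u) 2 volume).toReal}

namespace Cub
open scoped SchwartzMap FourierTransform

/-- multiplication by the variable -/
noncomputable def X : 𝓢(ℝ, ℂ) →L[ℂ] 𝓢(ℝ, ℂ) :=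
  SchwartzMap.smulLeftCLM ℂ (fun x : ℝ => (x : ℂ))

/-- derivative -/
noncomputable def D : 𝓢(ℝ, ℂ) →L[ℂ] 𝓢(ℝ, ℂ) := SchwartzMap.derivCLM ℂ ℂ

/-- embedding in L² -/
noncomputable def J : 𝓢(ℝ, ℂ) →L[ℂ] Lp ℂ 2 (volume : Measure ℝ) :=
  SchwartzMap.toLpCLM ℂ ℂ 2 volume

lemma tg_ofReal : Function.HasTemperateGrowth (fun x : ℝ => (x : ℂ)) := 
  Complex.ofRealCLM.hasTemperateGrowth

@[simp] lemma X_apply (f : 𝓢(ℝ, ℂ)) (x : ℝ) : X f x = x * f x := by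
  simp [X, SchwartzMap.smulLeftCLM_apply_apply tg_ofReal]

@[simp] lemma D_apply (f : 𝓢(ℝ, ℂ)) (x : ℝ) : D f x = deriv f x := rfl

lemma D_coe (f : 𝓢(ℝ, ℂ)) : ⇑(D f) = deriv f := rfl

lemma inner_J (f g : 𝓢(ℝ, ℂ)) : inner ℂ (J f) (J g) = ∫ x, g x * (starRingEnd ℂ) (f x) := by
  simp [J, SchwartzMap.inner_toL2_toL2_eq]

lemma X_symm (f g : 𝓢(ℝ, ℂ)) : inner ℂ (J (X f)) (J g) = inner ℂ (J f) (J (X g)) := by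
  rw [inner_J, inner_J]
  congr 1; ext x
  simp; ring

lemma D_skew (f g : 𝓢(ℝ, ℂ)) : inner ℂ (J (D f)) (J g) = - inner ℂ (J f) (J (D g)) := by
  rw [inner_J, inner_J]
  have h := SchwartzMap.integral_bilinear_deriv_right_eq_neg_left f g
    ((ContinuousLinearMap.mul ℝ ℂ).comp (Complex.conjCLE : ℂ →L[ℝ] ℂ))
  simp at h
  simp only [D_apply]
  simp_rw [mul_comm _ ((starRingEnd ℂ) _)]
  rw [h]; simp

lemma D_X (f : 𝓢(ℝ, ℂ)) : D (X f) = X (D f) + f := by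
  ext x
  have h : HasDerivAt (X f) (1 * f x + x * deriv f x) x := by
    have := (Complex.ofRealCLM.hasDerivAt (x := x)).mul (f.hasDerivAt x)
    simp at this
    have e : ⇑(X f) = ⇑ofRealCLM * ⇑f := by ext y; simp
    rw [e, one_mul]; exact this
  simp [h.deriv]; ring

/-- the operator P - z on Schwartz functions -/
noncomputable def Op (z : ℂ) (u : 𝓢(ℝ, ℂ)) : 𝓢(ℝ, ℂ) :=
  -(D (D u)) + Complex.I • X (X (X u)) - z • u

lemma norm_J (f : 𝓢(ℝ, ℂ)) : ‖J f‖ = (eLpNorm f 2 volume).toReal := by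
  simp [J, SchwartzMap.norm_toLp]

lemma Op_coe (z : ℂ) (u : 𝓢(ℝ, ℂ)) : ⇑(Op z u) = (fun x : ℝ =>
          -(deriv (deriv ⇑u) x) + Complex.I * (x:ℂ) ^ 3 * u x - z * u x) := by
  ext x
  simp [Op, D_coe]; ring

lemma mP_eq (z : ℂ) : mP z = sInf {r : ℝ | ∃ u : 𝓢(ℝ, ℂ), u ≠ 0 ∧ r = ‖J (Op z u)‖ / ‖J u‖} := by
  simp only [mP, norm_J, Op_coe]

lemma mP_le (z : ℂ) (u : 𝓢(ℝ, ℂ)) (hu : u ≠ 0) : mP z ≤ ‖J (Op z u)‖ / ‖J u‖ := by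
  rw [mP_eq]
  refine csInf_le ⟨0, ?_⟩ ⟨u, hu, rfl⟩
  rintro r ⟨u, -, rfl⟩
  positivity

lemma J_pos (u : 𝓢(ℝ, ℂ)) (hu : u ≠ 0) : 0 < ‖J u‖ := by
  rw [norm_pos_iff]
  intro h
  apply hu
  have := SchwartzMap.injective_toLp (E := ℝ) (F := ℂ) 2 (volume : Measure ℝ)
  apply this
  have h0 : J 0 = 0 := map_zero _
  exact h.trans h0.symm

lemma le_mP (z : ℂ) (c : ℝ) (h : ∀ u, c * ‖J u‖ ≤ ‖J (Op z u)‖) (h0 : mP z ≠ 0) : c ≤ mP z := by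
  rw [mP_eq] at *
  apply le_csInf
  · by_contra hne
    rw [Set.not_nonempty_iff_eq_empty] at hne
    rw [hne] at h0; simp at h0
  · rintro r ⟨u, hu, rfl⟩
    rw [le_div_iff₀ (J_pos u hu)]
    exact h u

lemma norm_J_fourier (f : 𝓢(ℝ, ℂ)) : ‖J (𝓕 f)‖ = ‖J f‖ := by
  simp [J]

lemma X_fourier (f : 𝓢(ℝ, ℂ)) : (2 * Real.pi * Complex.I) • X (𝓕 f) = 𝓕 (D f) := by
  ext x
  have := Real.fourier_deriv (f := f) f.integrable f.differentiable (D f).integrable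
  simp [SchwartzMap.fourier_coe, D_coe]
  rw [this]; simp; ring

lemma D_fourier (f : 𝓢(ℝ, ℂ)) : D (𝓕 f) = (-(2 * Real.pi * Complex.I)) • 𝓕 (X f) := by
  ext x
  have hi : Integrable (fun x : ℝ => x • f x) := by
    refine ((X f).integrable (μ := volume)).congr (Filter.Eventually.of_forall fun y => ?_)
    simp
  have h := Real.deriv_fourier (f := f) f.integrable hi
  simp [SchwartzMap.fourier_coe, h]
  simp only [Real.fourier_eq', ← integral_const_mul]
  rw [← integral_neg]
  congr 1; ext y; simp; ring

end Cub

namespace Cub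
open scoped SchwartzMap FourierTransform

/-- multiplication by `x - a` -/
noncomputable def T (a : ℝ) (u : 𝓢(ℝ, ℂ)) : 𝓢(ℝ, ℂ) := X u - (a : ℂ) • u

@[simp] lemma T_apply (a : ℝ) (f : 𝓢(ℝ, ℂ)) (x : ℝ) : T a f x = (x - a) * f x := by
  simp [T]; ring

lemma T_symm (a : ℝ) (f g : 𝓢(ℝ, ℂ)) : inner ℂ (J (T a f)) (J g) = inner ℂ (J f) (J (T a g)) := by
  simp only [T, map_sub, map_smul, inner_sub_left, inner_sub_right, X_symm, inner_smul_left,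
    inner_smul_right, Complex.conj_ofReal]

lemma D_T (a : ℝ) (f : 𝓢(ℝ, ℂ)) : D (T a f) = T a (D f) + f := by
  simp only [T, map_sub, D_X, map_smul]; abel

lemma inner_re_im_zero {x y : Lp ℂ 2 (volume : Measure ℝ)} (h : inner ℂ x y = inner ℂ y x) :
    (inner ℂ x y).im = 0 := by
  rw [← inner_conj_symm y x] at h
  exact Complex.conj_eq_iff_im.1 h.symm

lemma energy1 (z : ℂ) (u : 𝓢(ℝ, ℂ)) :
    ‖J (D u)‖ ^ 2 ≤ ‖J (Op z u)‖ * ‖J u‖ + z.re * ‖J u‖ ^ 2 := by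
  have h1 : inner ℂ (J u) (J (Op z u)) = inner ℂ (J (D u)) (J (D u))
      + I * inner ℂ (J (X u)) (J (X (X u))) - z * inner ℂ (J u) (J u) := by
    simp only [Op, map_sub, map_add, map_neg, map_smul, inner_add_right, inner_sub_right,
      inner_neg_right, inner_smul_right]
    rw [D_skew, X_symm]
  have h2 : (inner ℂ (J (X u)) (J (X (X u)))).im = 0 := by
    apply inner_re_im_zero
    rw [X_symm (X u) (X u)]
  have h3 := congrArg Complex.re h1
  rw [inner_self_eq_norm_sq_to_K, inner_self_eq_norm_sq_to_K] at h3
  have h4 : (inner ℂ (J u) (J (Op z u))).re ≤ ‖J u‖ * ‖J (Op z u)‖ :=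
    (Complex.re_le_norm _).trans (norm_inner_le_norm _ _)
  simp [h2, ← Complex.ofReal_pow] at h3
  nlinarith

lemma X3_eq (a : ℝ) (u : 𝓢(ℝ, ℂ)) : X (X (X u)) = T a (T a (T a u)) + (3 * a : ℂ) • T a (T a u)
    + (3 * a ^ 2 : ℂ) • T a u + (a ^ 3 : ℂ) • u := by
  ext x; simp; ring

/-- the remainder after linearisation -/
noncomputable def Rem (a : ℝ) (u : 𝓢(ℝ, ℂ)) : 𝓢(ℝ, ℂ) := 
  T a (T a (T a u)) + (3 * a : ℂ) • T a (T a u)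

/-- the complex Airy operator -/
noncomputable def Ai (a c l : ℝ) (u : 𝓢(ℝ, ℂ)) : 𝓢(ℝ, ℂ) := 
  -(D (D u)) + (Complex.I * c) • T a u - (l : ℂ) • u

lemma Op_eq_Ai (a l : ℝ) (u : 𝓢(ℝ, ℂ)) :
    Op (l + a ^ 3 * I) u = Ai a (3 * a ^ 2) l u + I • Rem a u := by
  ext x
  simp [Op, Ai, Rem]; ring

lemma energy2_aux {a s N2 g d : ℝ} (ha : 0 < a) (hs0 : 0 ≤ s) (hN2 : 0 ≤ N2) (hg : 0 ≤ g)
    (hd : 0 ≤ d)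
    (key : s ^ 2 + 3 / 4 * a ^ 2 * N2 ^ 2 ≤ (s + 3 / 2 * a * N2) * g + 3 * (N2 * d)) :
    s + 3 / 2 * a * N2 ≤ 4 * g + 8 / a * d := by
  set m := s + 3 / 2 * a * N2 with hm
  have hm0 : 0 ≤ m := by positivity
  have k2 : m ^ 2 / 4 ≤ m * (g + 2 * d / a) := by
    have e : 3 * (N2 * d) = (3 / 2 * a * N2) * (2 * d / a) := by field_simp
    have : (3 / 2 * a * N2) * (2 * d / a) ≤ m * (2 * d / a) := by
      apply mul_le_mul_of_nonneg_right _ (by positivity)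
      rw [hm]; linarith
    have h2 : m ^ 2 / 4 ≤ s ^ 2 + 3 / 4 * a ^ 2 * N2 ^ 2 := by
      rw [hm]; nlinarith [sq_nonneg (s - 1 / 2 * a * N2)]
    rw [mul_add]; linarith
  rcases hm0.eq_or_lt with h | h
  · rw [← h]; positivity
  · have : m ≤ 4 * (g + 2 * d / a) := by
      by_contra hc
      push Not at hc
      nlinarith
    refine this.trans (le_of_eq ?_); ring

lemma energy2 (a l : ℝ) (ha : 0 < a) (u : 𝓢(ℝ, ℂ)) :
    ‖J (Rem a u)‖ ≤ 4 * ‖J (Op (l + a ^ 3 * I) u)‖ + 8 / a * ‖J (D u)‖ := by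
  set f := Op (l + a ^ 3 * I) u with hf
  set t1 := T a u with ht1
  set t2 := T a t1 with ht2
  set t3 := T a t2 with ht3
  have hfe : f = -(D (D u)) + I • (t3 + (3 * a : ℂ) • t2 + (3 * a ^ 2 : ℂ) • t1) - (l : ℂ) • u := by
    rw [hf, Op_eq_Ai]
    ext x
    simp [Ai, Rem, t1, t2, t3]; ring
  have hD : D t3 = T a (T a (T a (D u))) + (3 : ℂ) • t2 := by
    simp only [t3, t2, t1, D_T]
    ext x; simp; ring
  have h1 : inner ℂ (J t3) (J f) = inner ℂ (J (T a (T a (T a (D u))))) (J (D u))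
      + 3 * inner ℂ (J t2) (J (D u)) + I * (inner ℂ (J t3) (J t3) + 3 * a * inner ℂ (J t3) (J t2)
        + 3 * a ^ 2 * inner ℂ (J t2) (J t2)) - l * inner ℂ (J t3) (J u) := by
    have e1 : inner ℂ (J t3) (J (D (D u))) = - inner ℂ (J (D t3)) (J (D u)) := by
      rw [D_skew, neg_neg]
    have e2 : inner ℂ (J t3) (J t1) = inner ℂ (J t2) (J t2) := by rw [ht3, T_symm]
    rw [hfe]
    simp only [map_sub, map_add, map_neg, map_smul, inner_add_right, inner_sub_right,
      inner_neg_right, inner_smul_right, e1, hD, inner_add_left, inner_smul_left, e2]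
    have e3 : (starRingEnd ℂ) 3 = 3 := Complex.conj_ofReal 3
    rw [e3]; ring
  have i1 : (inner ℂ (J (T a (T a (T a (D u))))) (J (D u))).im = 0 := by
    apply inner_re_im_zero
    rw [T_symm, T_symm, T_symm]
  have i2 : (inner ℂ (J t3) (J t2)).im = 0 := by
    apply inner_re_im_zero
    rw [ht3, T_symm]
  have i3 : (inner ℂ (J t3) (J u)).im = 0 := by
    apply inner_re_im_zero
    rw [ht3, T_symm, ht2, T_symm, ht1, T_symm]
  have h3 := congrArg Complex.im h1
  rw [inner_self_eq_norm_sq_to_K, inner_self_eq_norm_sq_to_K] at h3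
  have h4 : (inner ℂ (J t3) (J f)).im ≤ ‖J t3‖ * ‖J f‖ :=
    (Complex.im_le_norm _).trans (norm_inner_le_norm _ _)
  have h5 : |(inner ℂ (J t2) (J (D u))).im| ≤ ‖J t2‖ * ‖J (D u)‖ :=
    (Complex.abs_im_le_norm _).trans (norm_inner_le_norm _ _)
  simp [i1, i3, ← Complex.ofReal_pow] at h3
  set s := ‖J t3 + (3 / 2 * a : ℂ) • J t2‖ with hs
  have h6 : s ^ 2 = ‖J t3‖ ^ 2 + 3 * a * (inner ℂ (J t3) (J t2)).re + 9 / 4 * a ^ 2 * ‖J t2‖ ^ 2 := by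
    rw [hs, @norm_add_sq ℂ, inner_smul_right, norm_smul]
    simp [abs_of_pos ha]; ring
  have h7 : ‖J t3‖ ≤ s + 3 / 2 * a * ‖J t2‖ := by
    have : J t3 = (J t3 + (3 / 2 * a : ℂ) • J t2) - (3 / 2 * a : ℂ) • J t2 := by abel
    rw [this]
    refine (norm_sub_le _ _).trans ?_
    rw [norm_smul]; simp [abs_of_pos ha, ← hs]
  have h8 : ‖J (Rem a u)‖ ≤ s + 3 / 2 * a * ‖J t2‖ := by
    have : J (Rem a u) = (J t3 + (3 / 2 * a : ℂ) • J t2) + (3 / 2 * a : ℂ) • J t2 := by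
      simp only [Rem, map_add, map_smul]
      rw [add_assoc, ← add_smul]; congr 2; ring
    rw [this]
    refine (norm_add_le _ _).trans ?_
    rw [norm_smul]; simp [abs_of_pos ha, ← hs]
  refine h8.trans ?_
  have hs0 : 0 ≤ s := norm_nonneg _
  have hN2 : 0 ≤ ‖J t2‖ := norm_nonneg _
  have hg : 0 ≤ ‖J f‖ := norm_nonneg _
  have hd : 0 ≤ ‖J (D u)‖ := norm_nonneg _
  apply energy2_aux ha hs0 hN2 hg hd
  have := mul_le_mul_of_nonneg_right h7 hg
  have h5' := (abs_le.1 h5).1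
  linarith
end Cub

namespace Cub
open scoped SchwartzMap FourierTransform ENNReal

lemma cs_lintegral (ν : Measure ℝ) [IsFiniteMeasure ν] (g : ℝ → ℝ≥0∞) (hg : Measurable g) :
    (∫⁻ s, g s ∂ν) ^ 2 ≤ ν Set.univ * ∫⁻ s, g s ^ 2 ∂ν := by
  have h := ENNReal.lintegral_mul_le_Lp_mul_Lq ν Real.HolderConjugate.two_two
    (f := fun _ => 1) (g := g) aemeasurable_const hg.aemeasurable
  simp at h
  calc (∫⁻ s, g s ∂ν) ^ 2 ≤ (ν Set.univ ^ ((2:ℝ)⁻¹) * (∫⁻ s, g s ^ 2 ∂ν) ^ ((2:ℝ)⁻¹)) ^ 2 := by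
        gcongr
    _ = _ := by
        rw [mul_pow, ← ENNReal.rpow_natCast, ← ENNReal.rpow_mul, ← ENNReal.rpow_natCast,
          ← ENNReal.rpow_mul]
        norm_num

lemma young (ν : Measure ℝ) [IsFiniteMeasure ν] (g : ℝ → ℂ) (hg : Continuous g) :
    ∫⁻ ξ, (∫⁻ s, ‖g (ξ + s)‖ₑ ∂ν) ^ 2 ≤ (ν Set.univ) ^ 2 * ∫⁻ ξ, ‖g ξ‖ₑ ^ 2 := by
  calc ∫⁻ ξ, (∫⁻ s, ‖g (ξ + s)‖ₑ ∂ν) ^ 2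
      ≤ ∫⁻ ξ, ν Set.univ * ∫⁻ s, ‖g (ξ + s)‖ₑ ^ 2 ∂ν := by
        apply lintegral_mono
        intro ξ
        apply cs_lintegral
        have : Continuous (fun s => g (ξ + s)) := by fun_prop
        exact this.measurable.enorm
    _ = ν Set.univ * ∫⁻ ξ, ∫⁻ s, ‖g (ξ + s)‖ₑ ^ 2 ∂ν := by
        rw [lintegral_const_mul' _ _ (measure_ne_top _ _)]
    _ = ν Set.univ * ∫⁻ s, ∫⁻ ξ, ‖g (ξ + s)‖ₑ ^ 2 ∂volume ∂ν := by
        rw [lintegral_lintegral_swap]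
        apply Measurable.aemeasurable
        have : Continuous (fun p : ℝ × ℝ => g (p.1 + p.2)) := by fun_prop
        exact (this.measurable.enorm).pow_const 2
    _ = ν Set.univ * ∫⁻ s, (∫⁻ ξ, ‖g ξ‖ₑ ^ 2 ∂volume) ∂ν := by
        congr 1
        apply lintegral_congr
        intro s
        exact lintegral_add_right_eq_self (fun ξ => ‖g ξ‖ₑ ^ 2) s
    _ = _ := by
        rw [lintegral_const]; ring

lemma eLpNorm_sq (f : ℝ → ℂ) : (eLpNorm f 2 volume) ^ 2 = ∫⁻ x, ‖f x‖ₑ ^ 2 := by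
  rw [eLpNorm_eq_lintegral_rpow_enorm_toReal (by norm_num) (by norm_num)]
  simp
  rw [← ENNReal.rpow_natCast, ← ENNReal.rpow_mul]
  norm_num

/-- exponential measure -/
noncomputable def nu (β : ℝ) : Measure ℝ :=
  (volume.restrict (Set.Ioi 0)).withDensity (fun s => ENNReal.ofReal (Real.exp (-β * s)))

lemma nu_univ (β : ℝ) (hβ : 0 < β) : nu β Set.univ = ENNReal.ofReal (1 / β) := by
  rw [nu, withDensity_apply _ MeasurableSet.univ, Measure.restrict_univ,
    ← ofReal_integral_eq_lintegral_ofReal]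
  · congr 1
    have := integral_exp_mul_Ioi (a := -β) (by linarith) 0
    simpa using this
  · exact integrableOn_exp_mul_Ioi (by linarith) 0
  · exact Filter.Eventually.of_forall fun s => (Real.exp_pos _).le

lemma lp_bound' (β A : ℝ) (hβ : 0 < β) (hA : 0 ≤ A) (v g : ℝ → ℂ) (hg : Continuous g)
    (h : ∀ ξ, ‖v ξ‖ ≤ A * ∫ s in Set.Ioi (0:ℝ), Real.exp (-β * s) * ‖g (ξ + s)‖) :
    eLpNorm v 2 volume ≤ ENNReal.ofReal (A / β) * eLpNorm g 2 volume := by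
  have hfin : IsFiniteMeasure (nu β) := ⟨by rw [nu_univ β hβ]; exact ENNReal.ofReal_lt_top⟩
  have h1 : ∀ ξ, ‖v ξ‖ₑ ≤ ENNReal.ofReal A * ∫⁻ s, ‖g (ξ + s)‖ₑ ∂(nu β) := by
    intro ξ
    have e : ∫⁻ s, ‖g (ξ + s)‖ₑ ∂(nu β) =
        ∫⁻ s in Set.Ioi (0:ℝ), ENNReal.ofReal (Real.exp (-β * s) * ‖g (ξ + s)‖) := by
      rw [nu, lintegral_withDensity_eq_lintegral_mul _ (by fun_prop)
        (by
          have h1 := hg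
          have : Continuous (fun s => g (ξ + s)) := by fun_prop
          exact this.measurable.enorm)]
      apply lintegral_congr
      intro s
      simp only [Pi.mul_apply]
      rw [ENNReal.ofReal_mul (Real.exp_pos _).le, ofReal_norm]
    rw [e, ← ofReal_norm]
    refine (ENNReal.ofReal_le_ofReal (h ξ)).trans ?_
    rw [ENNReal.ofReal_mul hA]
    gcongr
    rw [integral_eq_lintegral_of_nonneg_ae]
    · exact ENNReal.ofReal_toReal_le
    · exact Filter.Eventually.of_forall fun s => by positivity
    · have : Continuous fun s => Real.exp (-β * s) * ‖g (ξ + s)‖ := by fun_prop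
      exact this.aestronglyMeasurable
  have h2 : (eLpNorm v 2 volume) ^ 2 ≤ (ENNReal.ofReal (A / β) * eLpNorm g 2 volume) ^ 2 := by
    rw [eLpNorm_sq, mul_pow, eLpNorm_sq]
    calc ∫⁻ x, ‖v x‖ₑ ^ 2 ≤ ∫⁻ x, ENNReal.ofReal A ^ 2 * (∫⁻ s, ‖g (x + s)‖ₑ ∂(nu β)) ^ 2 := by
          apply lintegral_mono
          intro x
          beta_reduce
          rw [← mul_pow]
          exact pow_le_pow_left' (h1 x) 2
      _ = ENNReal.ofReal A ^ 2 * ∫⁻ x, (∫⁻ s, ‖g (x + s)‖ₑ ∂(nu β)) ^ 2 := by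
          rw [lintegral_const_mul' _ _ (by simp)]
      _ ≤ ENNReal.ofReal A ^ 2 * ((nu β Set.univ) ^ 2 * ∫⁻ ξ, ‖g ξ‖ₑ ^ 2) := by
          gcongr
          exact young _ _ hg
      _ = _ := by
          rw [nu_univ β hβ, ← mul_assoc, ← mul_pow, ← ENNReal.ofReal_mul hA]
          have : A * (1 / β) = A / β := by ring
          rw [this]
  exact (ENNReal.pow_le_pow_left_iff (by norm_num)).1 h2

lemma lp_bound (β A : ℝ) (hβ : 0 < β) (hA : 0 ≤ A) (v g : 𝓢(ℝ, ℂ))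
    (h : ∀ ξ, ‖v ξ‖ ≤ A * ∫ s in Set.Ioi (0:ℝ), Real.exp (-β * s) * ‖g (ξ + s)‖) :
    ‖J v‖ ≤ A / β * ‖J g‖ := by
  have h3 := lp_bound' β A hβ hA v g g.continuous h
  have hA' : 0 ≤ A / β := by positivity
  have h5 : ENNReal.ofReal (A / β) * eLpNorm g 2 volume ≠ ⊤ := 
    ENNReal.mul_ne_top ENNReal.ofReal_ne_top (SchwartzMap.eLpNorm_lt_top g 2 volume).ne
  have h4 := ENNReal.toReal_mono h5 h3
  rw [ENNReal.toReal_mul, ENNReal.toReal_ofReal hA'] at h4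
  rw [norm_J, norm_J]
  exact h4
end Cub

namespace Cub
open scoped SchwartzMap FourierTransform ENNReal

lemma Ai_fourier (a c l : ℝ) (u : 𝓢(ℝ, ℂ)) (ξ : ℝ) :
    (𝓕 (Ai a c l u) : 𝓢(ℝ, ℂ)) ξ = (4 * Real.pi ^ 2 * ξ ^ 2 - l - I * c * a) * (𝓕 u : 𝓢(ℝ, ℂ)) ξ
      - c / (2 * Real.pi) * deriv (⇑(𝓕 u : 𝓢(ℝ, ℂ))) ξ := by
  have hpi : (Real.pi : ℂ) ≠ 0 := by exact_mod_cast Real.pi_ne_zero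
  have h1 : 𝓕 (D (D u)) = (2 * Real.pi * I) • X ((2 * Real.pi * I) • X (𝓕 u)) := by
    rw [X_fourier, X_fourier]
  have h2 : 𝓕 (X u) = (I / (2 * Real.pi)) • D (𝓕 u) := by
    rw [D_fourier, smul_smul]
    have : I / (2 * Real.pi) * -(2 * Real.pi * I) = 1 := by
      field_simp
      simp
    rw [this, one_smul]
  have h3 : 𝓕 (Ai a c l u) = -(𝓕 (D (D u))) + (I * c) • (𝓕 (X u) - (a : ℂ) • 𝓕 u) - (l : ℂ) • 𝓕 u := by
    have : ∀ f : 𝓢(ℝ, ℂ), 𝓕 f = SchwartzMap.fourierTransformCLM ℂ f := fun f => rfl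
    simp only [this, Ai, T, map_sub, map_add, map_neg, map_smul]
  rw [h3, h1, h2]
  have hI : I ^ 2 = -1 := Complex.I_sq
  simp
  field_simp
  ring_nf
  rw [hI]; ring

lemma airy (a c l b C : ℝ) (hc : 0 < c) (hb : 0 < b)
    (hC : ∀ τ : ℝ, 0 ≤ τ → (l + b) * τ - c ^ 2 * τ ^ 3 / 12 ≤ C) (u : 𝓢(ℝ, ℂ)) :
    ‖J u‖ ≤ Real.exp C / b * ‖J (Ai a c l u)‖ := by
  have hpi := Real.pi_pos
  set v := 𝓕 u with hv
  set G := 𝓕 (Ai a c l u) with hG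
  rw [← norm_J_fourier u, ← norm_J_fourier (Ai a c l u), ← hv, ← hG]
  set β := 2 * Real.pi * b / c with hβ
  have hβ0 : 0 < β := by positivity
  set Φ : ℝ → ℝ := fun η => (2 * Real.pi / c) * (4 * Real.pi ^ 2 * η ^ 3 / 3 - l * η) with hΦ
  have hkey : ∀ ξ s, 0 ≤ s → β * s - C ≤ Φ (ξ + s) - Φ ξ := by
    intro ξ s hs
    have h := hC (2 * Real.pi / c * s) (by positivity)
    have e : Φ (ξ + s) - Φ ξ - (β * s - C) = (C - ((l + b) * (2 * Real.pi / c * s)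
        - c ^ 2 * (2 * Real.pi / c * s) ^ 3 / 12)) + 8 * Real.pi ^ 3 / c * s * (ξ + s / 2) ^ 2 := by
      simp only [hΦ, hβ]; field_simp; ring
    have : 0 ≤ 8 * Real.pi ^ 3 / c * s * (ξ + s / 2) ^ 2 := by positivity
    linarith
  set Ψ : ℝ → ℂ := fun η => (2 * Real.pi / c) * (4 * Real.pi ^ 2 * η ^ 3 / 3 - l * η - I * c * a * η)
    with hΨ
  have hre : ∀ η, (Ψ η).re = Φ η := by
    intro η
    have : Ψ η = (Φ η : ℂ) - I * ((2 * Real.pi / c * c * a * η : ℝ) : ℂ) := by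
      simp only [hΨ, hΦ]; push_cast; ring
    rw [this]; simp
  have hdΨ : ∀ η : ℝ, HasDerivAt Ψ ((2 * Real.pi / c) * (4 * Real.pi ^ 2 * η ^ 2 - l - I * c * a)) η := by
    intro η
    have h0 : HasDerivAt (fun x : ℝ => (x : ℂ)) 1 η := (hasDerivAt_id η).ofReal_comp
    have := ((((h0.pow 3).const_mul (4 * Real.pi ^ 2 : ℂ)).div_const 3).sub (h0.const_mul (l : ℂ))).sub
      (h0.const_mul (I * c * a)) |>.const_mul (2 * Real.pi / c : ℂ)
    refine this.congr_deriv ?_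
    push_cast; ring
  have hcC : (c : ℂ) ≠ 0 := by exact_mod_cast hc.ne'
  have hpiC : (Real.pi : ℂ) ≠ 0 := by exact_mod_cast hpi.ne'
  have hdF : ∀ η : ℝ, HasDerivAt (fun η => exp (-Ψ η) * v η)
      (-((2 * Real.pi / c) * (exp (-Ψ η) * G η))) η := by
    intro η
    have := ((hdΨ η).neg.cexp).mul (v.hasDerivAt η)
    refine this.congr_deriv ?_
    rw [hG, Ai_fourier, ← hv]
    simp only [Pi.neg_apply]
    field_simp
    ring
  have hcontΨ : Continuous Ψ := by
    rw [hΨ]; fun_prop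
  apply (lp_bound β (2 * Real.pi / c * Real.exp C) hβ0 (by positivity) v G ?_).trans
  · apply le_of_eq
    rw [hβ]; field_simp
  intro ξ
  have hexp : ∀ s, 0 ≤ s → ‖exp (Ψ ξ - Ψ (ξ + s))‖ ≤ Real.exp C * Real.exp (-β * s) := by
    intro s hs
    rw [Complex.norm_exp, Complex.sub_re, hre, hre, ← Real.exp_add]
    apply Real.exp_le_exp.2
    have := hkey ξ s hs
    linarith
  have hIntg : IntegrableOn (fun s => Real.exp (-β * s) * ‖G (ξ + s)‖) (Set.Ioi 0) := by
    have hb : Integrable (fun s => G (ξ + s)) := G.integrable.comp_add_left ξ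
    refine Integrable.mono' (hb.norm.integrableOn) ?_ ?_
    · have := G.continuous
      have : Continuous fun s => Real.exp (-β * s) * ‖G (ξ + s)‖ := by fun_prop
      exact this.aestronglyMeasurable
    · refine (ae_restrict_iff' measurableSet_Ioi).2 (Filter.Eventually.of_forall fun s hs => ?_)
      have : Real.exp (-β * s) ≤ 1 := by
        rw [Real.exp_le_one_iff]
        have : 0 < s := hs
        nlinarith
      rw [Real.norm_of_nonneg (by positivity)]
      exact mul_le_of_le_one_left (norm_nonneg _) this
  have hnb : ∀ s, 0 ≤ s → ‖-((2 * Real.pi / c : ℂ) * (exp (Ψ ξ - Ψ (ξ + s)) * G (ξ + s)))‖ ≤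
      (2 * Real.pi / c * Real.exp C) * (Real.exp (-β * s) * ‖G (ξ + s)‖) := by
    intro s hs
    rw [norm_neg, norm_mul, norm_mul]
    have e : ‖(2 * Real.pi / c : ℂ)‖ = 2 * Real.pi / c := by
      simp [abs_of_pos hpi, abs_of_pos hc]
    rw [e]
    have := hexp s hs
    calc 2 * Real.pi / c * (‖exp (Ψ ξ - Ψ (ξ + s))‖ * ‖G (ξ + s)‖) ≤
        2 * Real.pi / c * ((Real.exp C * Real.exp (-β * s)) * ‖G (ξ + s)‖) := by gcongr
      _ = _ := by ring
  have hder : ∀ s ∈ Set.Ici (0:ℝ), HasDerivAt (fun s => exp (Ψ ξ - Ψ (ξ + s)) * v (ξ + s))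
      (-((2 * Real.pi / c : ℂ) * (exp (Ψ ξ - Ψ (ξ + s)) * G (ξ + s)))) s := by
    intro s _
    have h1 := (hdF (ξ + s)).comp_const_add ξ s
    have := h1.const_mul (exp (Ψ ξ))
    have e : (fun s => exp (Ψ ξ - Ψ (ξ + s)) * v (ξ + s)) =
        fun t => exp (Ψ ξ) * (exp (-Ψ (ξ + t)) * v (ξ + t)) := by
      funext t; rw [← mul_assoc, ← Complex.exp_add]; rfl
    rw [e]
    refine this.congr_deriv ?_
    rw [sub_eq_add_neg, Complex.exp_add]; ring
  have hF := integral_Ioi_of_hasDerivAt_of_tendsto' (m := 0) hder ?_ ?_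
  · simp at hF
    have hvle : ‖v ξ‖ ≤ ∫ s in Set.Ioi (0:ℝ), (2 * Real.pi / c * Real.exp C) * (Real.exp (-β * s) * ‖G (ξ + s)‖) := by
      have e : ‖v ξ‖ = ‖∫ s in Set.Ioi (0:ℝ), -((2 * Real.pi / c : ℂ) * (exp (Ψ ξ - Ψ (ξ + s)) * G (ξ + s)))‖ := by
        rw [hF, norm_neg]
      rw [e]
      apply norm_integral_le_of_norm_le (hIntg.const_mul _)
      exact (ae_restrict_iff' measurableSet_Ioi).2 (Filter.Eventually.of_forall fun s hs => hnb s (le_of_lt hs))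
    rwa [integral_const_mul] at hvle
  · refine Integrable.mono' (hIntg.const_mul (2 * Real.pi / c * Real.exp C)) ?_ ?_
    · have := G.continuous
      apply Continuous.aestronglyMeasurable
      fun_prop
    · exact (ae_restrict_iff' measurableSet_Ioi).2 (Filter.Eventually.of_forall fun s hs => hnb s (le_of_lt hs))
  · have hv0 : Filter.Tendsto v (Filter.cocompact ℝ) (nhds 0) := v.tendsto_cocompact
    have hv1 : Filter.Tendsto (fun s => v (ξ + s)) Filter.atTop (nhds 0) :=
      (hv0.mono_left atTop_le_cocompact).comp (Filter.tendsto_atTop_add_const_left _ _ Filter.tendsto_id)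
    rw [tendsto_zero_iff_norm_tendsto_zero] at hv1 ⊢
    have hv2 := hv1.const_mul (Real.exp C)
    rw [mul_zero] at hv2
    refine squeeze_zero' (Filter.Eventually.of_forall fun s => norm_nonneg _) ?_ hv2
    filter_upwards [Filter.eventually_ge_atTop 0] with s hs
    rw [norm_mul]
    gcongr
    refine (hexp s hs).trans ?_
    apply mul_le_of_le_one_right (Real.exp_pos _).le
    rw [Real.exp_le_one_iff]
    nlinarith
end Cub

namespace Cub
open scoped SchwartzMap FourierTransform ENNReal

lemma lower_quant (a l b p : ℝ) (ha : 1 ≤ a) (hl : 0 ≤ l) (hla : l + 1 ≤ a ^ 2) (hb : 0 < b)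
    (hp : 0 ≤ p) (hlb : l + b = p ^ 2)
    (hr : Real.exp (4 / 3 * p ^ 3 / (3 * a ^ 2)) / b ≤ 1 / 16) (u : 𝓢(ℝ, ℂ)) :
    ‖J u‖ ≤ 26 * (Real.exp (4 / 3 * p ^ 3 / (3 * a ^ 2)) / b) * ‖J (Op (l + a ^ 3 * I) u)‖ := by
  have ha0 : 0 < a := by linarith
  have h1 := energy1 (l + a ^ 3 * I) u
  have h2 := energy2 a l ha0 u
  have h3 := airy a (3 * a ^ 2) l b (4 / 3 * p ^ 3 / (3 * a ^ 2)) (by positivity) hb ?_ u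
  · have e : Ai a (3 * a ^ 2) l u = Op (l + a ^ 3 * I) u - I • Rem a u := by
      rw [Op_eq_Ai]; push_cast; abel
    have h4 : ‖J (Ai a (3 * a ^ 2) l u)‖ ≤ ‖J (Op (l + a ^ 3 * I) u)‖ + ‖J (Rem a u)‖ := by
      rw [e, map_sub, map_smul]
      refine (norm_sub_le _ _).trans ?_
      rw [norm_smul]; simp
    have hre : ((l : ℂ) + a ^ 3 * I).re = l := by
      simp [← Complex.ofReal_pow]
    rw [hre] at h1
    push_cast at h3 h4
    set r := Real.exp (4 / 3 * p ^ 3 / (3 * a ^ 2)) / b with hrdef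
    have hr0 : 0 < r := by positivity
    set N := ‖J u‖
    set F := ‖J (Op (l + a ^ 3 * I) u)‖
    set d := ‖J (D u)‖
    have hN : 0 ≤ N := norm_nonneg _
    have hF : 0 ≤ F := norm_nonneg _
    have hd : d ≤ F + a * N := by
      apply abs_le_of_sq_le_sq' ?_ (by positivity) |>.2
      nlinarith [mul_nonneg hN hF, mul_nonneg ha0.le (mul_nonneg hN hF), sq_nonneg (F - N), mul_nonneg (sub_nonneg.2 hla) (sq_nonneg N)]
    have h5 : 8 / a * d ≤ 8 * F + 8 * N := by
      have : 8 / a * d ≤ 8 / a * (F + a * N) := by gcongr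
      have e2 : 8 / a * (F + a * N) = 8 / a * F + 8 * N := by field_simp
      have : 8 / a * F ≤ 8 * F := by
        gcongr
        rw [div_le_iff₀ ha0]; linarith
      linarith
    have h6 : N ≤ r * (13 * F + 8 * N) := by
      refine h3.trans ?_
      gcongr
      linarith
    nlinarith
  · intro τ hτ
    rw [hlb]
    have key : 0 ≤ (p - 3 * a ^ 2 * τ / 2) ^ 2 * (2 * p + 3 * a ^ 2 * τ / 2) := by positivity
    have e : 4 / 3 * p ^ 3 / (3 * a ^ 2) - (p ^ 2 * τ - (3 * a ^ 2) ^ 2 * τ ^ 3 / 12) =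
      2 / (9 * a ^ 2) * ((p - 3 * a ^ 2 * τ / 2) ^ 2 * (2 * p + 3 * a ^ 2 * τ / 2)) := by
      field_simp; ring
    have : 0 ≤ 2 / (9 * a ^ 2) * ((p - 3 * a ^ 2 * τ / 2) ^ 2 * (2 * p + 3 * a ^ 2 * τ / 2)) := by positivity
    linarith

/-- main scale -/
noncomputable def Lam (y : ℝ) : ℝ := y ^ ((4:ℝ)/9) * (Real.log y) ^ ((2:ℝ)/3)

lemma Lam_small : ∀ᶠ y : ℝ in Filter.atTop, Lam y + 1 ≤ y ^ ((2:ℝ)/3) := by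
  have h1 := (isLittleO_log_rpow_rpow_atTop (s := (1:ℝ)/9) (2/3:ℝ) (by norm_num)).bound
    (c := 1/2) (by norm_num)
  have h2 := (tendsto_rpow_atTop (y := (2:ℝ)/3) (by norm_num)).eventually_ge_atTop 2
  filter_upwards [h1, h2, Filter.eventually_ge_atTop 1] with y h1 h2 h3
  have h0 : (0:ℝ) < y := by linarith
  have hl : 0 ≤ Real.log y := Real.log_nonneg h3
  rw [Real.norm_of_nonneg (by positivity), Real.norm_of_nonneg (by positivity)] at h1
  have e : y ^ ((4:ℝ)/9) * y ^ ((1:ℝ)/9) = y ^ ((5:ℝ)/9) := by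
    rw [← Real.rpow_add h0]; norm_num
  have e2 : y ^ ((5:ℝ)/9) ≤ y ^ ((2:ℝ)/3) := Real.rpow_le_rpow_of_exponent_le h3 (by norm_num)
  have : Lam y ≤ y ^ ((4:ℝ)/9) * (1/2 * y ^ ((1:ℝ)/9)) := by
    unfold Lam; gcongr
  linarith

lemma partA (δ ε : ℝ) (hδ : 0 < δ) (hδ1 : δ < 1) (hε : 0 < ε) :
    ∀ᶠ y : ℝ in Filter.atTop, ∀ z : ℂ, z.im = y → 0 ≤ z.re → z.re ≤ (1 - δ) * Lam y →
      mP z ≠ 0 → ε < mP z := by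
  set θ := (1 - δ / 2) ^ ((3:ℝ)/2) with hθ
  have hθ1 : θ < 1 := Real.rpow_lt_one (by linarith) (by linarith) (by norm_num)
  have ht : Filter.Tendsto (fun y : ℝ => 2 / δ * y ^ (-(4 / 9 * (1 - θ)))) Filter.atTop (nhds 0) := by
    have := (tendsto_rpow_neg_atTop (y := 4 / 9 * (1 - θ)) (by linarith)).const_mul (2 / δ)
    simpa using this
  have hm : 0 < min (1/16) (1 / (26 * (2 * ε))) := by positivity
  filter_upwards [ht.eventually (ge_mem_nhds hm), Lam_small, Filter.eventually_ge_atTop 3] with y h1 h2 h3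
    z hz hre hle h0
  have hy0 : (0:ℝ) < y := by linarith
  have hlog1 : 1 ≤ Real.log y := by
    rw [Real.le_log_iff_exp_le hy0]
    linarith [Real.exp_one_lt_d9]
  have hL : y ^ ((4:ℝ)/9) ≤ Lam y := by
    unfold Lam
    apply le_mul_of_one_le_right (by positivity)
    exact Real.one_le_rpow hlog1 (by norm_num)
  have hL0 : 0 < Lam y := lt_of_lt_of_le (by positivity) hL
  set a := y ^ ((1:ℝ)/3) with ha
  set p := (1 - δ/2) ^ ((1:ℝ)/2) * y ^ ((2:ℝ)/9) * (Real.log y) ^ ((1:ℝ)/3) with hp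
  have hd2 : 0 < 1 - δ / 2 := by linarith
  have hlog0 : 0 < Real.log y := by linarith
  have ha2 : a ^ 2 = y ^ ((2:ℝ)/3) := by
    rw [ha, ← Real.rpow_natCast, ← Real.rpow_mul hy0.le]; norm_num
  have ha3 : a ^ 3 = y := by
    rw [ha, ← Real.rpow_natCast, ← Real.rpow_mul hy0.le]; norm_num
  have hp2 : p ^ 2 = (1 - δ/2) * Lam y := by
    rw [hp, mul_pow, mul_pow, ← Real.rpow_natCast, ← Real.rpow_mul hd2.le, ← Real.rpow_natCast,
      ← Real.rpow_mul hy0.le, ← Real.rpow_natCast, ← Real.rpow_mul hlog0.le, Lam]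
    norm_num; ring
  have hp3 : p ^ 3 = θ * (a ^ 2 * Real.log y) := by
    rw [ha2, hp, mul_pow, mul_pow, ← Real.rpow_natCast, ← Real.rpow_mul hd2.le, ← Real.rpow_natCast,
      ← Real.rpow_mul hy0.le, ← Real.rpow_natCast, ← Real.rpow_mul hlog0.le]
    norm_num; ring
  set b := (1 - δ/2) * Lam y - z.re with hb
  have hblow : δ / 2 * Lam y ≤ b := by rw [hb]; linarith
  have hb0 : 0 < b := lt_of_lt_of_le (by positivity) hblow
  have ha1 : 1 ≤ a := Real.one_le_rpow (by linarith) (by norm_num)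
  have hr : Real.exp (4 / 3 * p ^ 3 / (3 * a ^ 2)) / b ≤ 2 / δ * y ^ (-(4 / 9 * (1 - θ))) := by
    have e1 : 4 / 3 * p ^ 3 / (3 * a ^ 2) = Real.log y * (4 / 9 * θ) := by
      rw [hp3]; field_simp; ring
    rw [e1, ← Real.rpow_def_of_pos hy0, div_le_iff₀ hb0]
    have e2 : y ^ (4 / 9 * θ) = y ^ (-(4 / 9 * (1 - θ))) * y ^ ((4:ℝ)/9) := by
      rw [← Real.rpow_add hy0]; ring_nf
    rw [e2]
    calc y ^ (-(4 / 9 * (1 - θ))) * y ^ ((4:ℝ)/9) ≤ y ^ (-(4 / 9 * (1 - θ))) * Lam y := by gcongr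
      _ = 2 / δ * y ^ (-(4 / 9 * (1 - θ))) * (δ / 2 * Lam y) := by field_simp
      _ ≤ _ := by gcongr
  have hr2 := hr.trans h1
  set r := Real.exp (4 / 3 * p ^ 3 / (3 * a ^ 2)) / b with hrdef
  have hr0 : 0 < r := by positivity
  have key := lower_quant a z.re b p ha1 hre (by rw [ha2]; nlinarith) hb0 (by positivity)
    (by rw [hp2, hb]; ring) (hr2.trans (min_le_left _ _))
  have hz' : (z.re : ℂ) + a ^ 3 * I = z := by
    rw [← Complex.ofReal_pow, ha3, ← hz, Complex.re_add_im]
  rw [hz'] at key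
  have hfin : 1 / (26 * r) ≤ mP z := by
    apply le_mP _ _ _ h0
    intro u
    have := key u
    rw [one_div, inv_mul_le_iff₀ (by positivity)]
    exact this
  have : 2 * ε ≤ 1 / (26 * r) := by
    have := hr2.trans (min_le_right _ _)
    rw [le_div_iff₀ (by positivity)] at this ⊢
    linarith
  linarith
end Cub

namespace Cub
open scoped SchwartzMap FourierTransform ENNReal

lemma norm_J_sq (f : 𝓢(ℝ, ℂ)) : ‖J f‖ ^ 2 = ∫ x, ‖f x‖ ^ 2 := by
  have h := inner_J f f
  rw [inner_self_eq_norm_sq_to_K] at h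
  have e : ∀ x, f x * (starRingEnd ℂ) (f x) = ((‖f x‖ ^ 2 : ℝ) : ℂ) := by
    intro x; rw [Complex.mul_conj, Complex.normSq_eq_norm_sq]
  simp_rw [e] at h
  rw [integral_complex_ofReal] at h
  rw [← RCLike.ofReal_pow] at h
  exact Complex.ofReal_injective h

/-- affine change of variables -/
noncomputable def S (a σ : ℝ) (hσ : σ ≠ 0) : 𝓢(ℝ, ℂ) →L[ℂ] 𝓢(ℝ, ℂ) :=
  (SchwartzMap.compSubConstCLM ℂ a).comp
    (SchwartzMap.compCLMOfContinuousLinearEquiv ℂ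
      (ContinuousLinearEquiv.unitsEquivAut ℝ (Units.mk0 σ hσ)))

lemma S_apply (a σ : ℝ) (hσ : σ ≠ 0) (f : 𝓢(ℝ, ℂ)) (x : ℝ) : S a σ hσ f x = f (σ * (x - a)) := by
  simp [S, SchwartzMap.compSubConstCLM_apply, mul_comm]

lemma D_S (a σ : ℝ) (hσ : σ ≠ 0) (f : 𝓢(ℝ, ℂ)) : D (S a σ hσ f) = (σ : ℂ) • S a σ hσ (D f) := by
  ext x
  have h1 : HasDerivAt (fun x : ℝ => σ * (x - a)) σ x := by
    simpa using ((hasDerivAt_id x).sub_const a).const_mul σ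
  have h2 : HasDerivAt (fun x => f (σ * (x - a))) (σ • deriv f (σ * (x - a))) x :=
    HasDerivAt.scomp x (f.hasDerivAt (σ * (x - a))) h1
  have e : ⇑(S a σ hσ f) = fun x => f (σ * (x - a)) := by ext x; exact S_apply _ _ _ _ _
  rw [D_apply, e, h2.deriv]
  simp [S_apply]

lemma T_S (a σ : ℝ) (hσ : σ ≠ 0) (f : 𝓢(ℝ, ℂ)) : T a (S a σ hσ f) = (1 / σ : ℂ) • S a σ hσ (X f) := by
  ext x
  have : (σ : ℂ) ≠ 0 := by exact_mod_cast hσ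
  simp [S_apply]
  field_simp

lemma norm_S (a σ : ℝ) (hσ : 0 < σ) (f : 𝓢(ℝ, ℂ)) :
    ‖J (S a σ hσ.ne' f)‖ ^ 2 = σ⁻¹ * ‖J f‖ ^ 2 := by
  rw [norm_J_sq, norm_J_sq]
  simp_rw [S_apply]
  rw [integral_sub_right_eq_self (fun x => ‖f (σ * x)‖ ^ 2) a,
    Measure.integral_comp_mul_left (fun x => ‖f x‖ ^ 2) σ]
  simp [abs_of_pos hσ]

lemma T_smul (a : ℝ) (c : ℂ) (f : 𝓢(ℝ, ℂ)) : T a (c • f) = c • T a f := by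
  ext x; simp; ring

/-- the operator on the Fourier side -/
noncomputable def OpF (a l κ : ℝ) (w : 𝓢(ℝ, ℂ)) : 𝓢(ℝ, ℂ) :=
  ((κ : ℂ) ^ 2) • X (X w) - (l : ℂ) • w + (3 * a ^ 2 / κ : ℂ) • D w
    - (3 * I * a / κ ^ 2 : ℂ) • D (D w) - (1 / κ ^ 3 : ℂ) • D (D (D w))

lemma Op_S (a l κ : ℝ) (hκ : 0 < κ) (w : 𝓢(ℝ, ℂ)) (hσ : κ / (2 * Real.pi) ≠ 0) :
    Op (l + a ^ 3 * I) (S a (κ / (2 * Real.pi)) hσ (𝓕 w)) =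
      S a (κ / (2 * Real.pi)) hσ (𝓕 (OpF a l κ w)) := by
  have hpi : (Real.pi : ℂ) ≠ 0 := by exact_mod_cast Real.pi_ne_zero
  have hk : (κ : ℂ) ≠ 0 := by exact_mod_cast hκ.ne'
  have hX : ∀ f : 𝓢(ℝ, ℂ), X (𝓕 f) = (1 / (2 * Real.pi * I)) • 𝓕 (D f) := by
    intro f
    rw [← X_fourier, smul_smul]
    have : 1 / (2 * Real.pi * I) * (2 * Real.pi * I) = 1 := by
      field_simp
    rw [this, one_smul]
  rw [Op_eq_Ai]
  have hD := D_S a (κ / (2 * Real.pi)) hσ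
  have hT := T_S a (κ / (2 * Real.pi)) hσ
  generalize S a (κ / (2 * Real.pi)) hσ = SS at *
  have hF : ∀ f : 𝓢(ℝ, ℂ), 𝓕 f = SchwartzMap.fourierTransformCLM ℂ f := fun f => rfl
  have e1 : D (D (SS (𝓕 w))) = -(((κ : ℂ) ^ 2) • SS (𝓕 (X (X w)))) := by
    rw [hD, map_smul, hD, D_fourier, map_smul, D_fourier]
    simp only [map_smul, smul_smul]
    rw [← neg_smul]
    congr 1
    push_cast; field_simp
    linear_combination Complex.I_sq
  have e2 : ∀ f : 𝓢(ℝ, ℂ), T a (SS (𝓕 f)) = (1 / (κ * I)) • SS (𝓕 (D f)) := by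
    intro f
    rw [hT, hX, map_smul, smul_smul]
    congr 1
    push_cast; field_simp
  rw [Ai, Rem, e1, e2, T_smul, e2, T_smul, T_smul, e2, OpF]
  simp only [hF, map_sub, map_add, map_smul, smul_smul]
  have hI2 : I ^ 2 = -1 := Complex.I_sq
  have hI3 : I ^ 3 = -I := by rw [pow_succ, hI2]; ring
  ext x
  simp
  field_simp
  ring_nf
  have hI4 : I ^ 4 = 1 := Complex.I_pow_four
  simp only [hI2, hI3, hI4]
  ring

lemma mP_fourier (a l κ : ℝ) (hκ : 0 < κ) (w : 𝓢(ℝ, ℂ)) (hw : w ≠ 0) :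
    mP (l + a ^ 3 * I) ≤ ‖J (OpF a l κ w)‖ / ‖J w‖ := by
  have hpi := Real.pi_pos
  have hσ : 0 < κ / (2 * Real.pi) := by positivity
  have hn : ∀ f : 𝓢(ℝ, ℂ), ‖J (S a _ hσ.ne' (𝓕 f))‖ = √((κ / (2 * Real.pi))⁻¹) * ‖J f‖ := by
    intro f
    have h := norm_S a _ hσ (𝓕 f)
    rw [norm_J_fourier] at h
    rw [← Real.sqrt_sq (norm_nonneg (J (S a _ hσ.ne' (𝓕 f)))), h, Real.sqrt_mul (by positivity),
      Real.sqrt_sq (norm_nonneg _)]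
  have hs : 0 < √((κ / (2 * Real.pi))⁻¹) := Real.sqrt_pos.2 (by positivity)
  have h0 : S a _ hσ.ne' (𝓕 w) ≠ 0 := by
    intro h
    have := hn w
    rw [h, map_zero, norm_zero] at this
    have := J_pos w hw
    have := mul_pos hs this
    linarith
  refine (mP_le _ _ h0).trans (le_of_eq ?_)
  rw [Op_S a l κ hκ w, hn, hn, mul_div_mul_left _ _ hs.ne']
end Cub

namespace Cub
open scoped SchwartzMap FourierTransform ENNReal ContDiff

lemma integrable_sq (f : 𝓢(ℝ, ℂ)) : Integrable (fun x => ‖f x‖ ^ 2) := 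
  (f.memLp 2 volume).integrable_norm_pow (by norm_num)

lemma gauss_up (f : 𝓢(ℝ, ℂ)) (M K : ℝ) (hK : 0 < K)
    (h : ∀ s, ‖f s‖ ≤ M * Real.exp (-(K * (s - 1) ^ 2 / 6))) :
    ‖J f‖ ^ 2 ≤ M ^ 2 * (√(3 * Real.pi) / √K) := by
  rw [norm_J_sq]
  have hi : Integrable (fun s : ℝ => M ^ 2 * Real.exp (-(K / 3) * (s - 1) ^ 2)) :=
    ((integrable_exp_neg_mul_sq (b := K / 3) (by positivity)).comp_sub_right 1).const_mul _
  calc ∫ x, ‖f x‖ ^ 2 ≤ ∫ s : ℝ, M ^ 2 * Real.exp (-(K / 3) * (s - 1) ^ 2) := by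
        apply integral_mono (integrable_sq f) hi
        intro s
        have h1 := pow_le_pow_left₀ (norm_nonneg _) (h s) 2
        refine h1.trans (le_of_eq ?_)
        rw [mul_pow, ← Real.exp_nat_mul]
        congr 2
        push_cast; ring
    _ = M ^ 2 * (√(3 * Real.pi) / √K) := by
        rw [integral_const_mul, integral_sub_right_eq_self (fun s => Real.exp (-(K / 3) * s ^ 2)) 1,
          integral_gaussian, ← Real.sqrt_div (by positivity)]
        congr 2
        field_simp

lemma box_up (f : 𝓢(ℝ, ℂ)) (M : ℝ) (h : ∀ s ∈ Set.Icc (-1:ℝ) 2, ‖f s‖ ≤ M)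
    (h0 : ∀ s ∉ Set.Icc (-1:ℝ) 2, f s = 0) : ‖J f‖ ^ 2 ≤ 3 * M ^ 2 := by
  rw [norm_J_sq]
  have e : ∫ x, ‖f x‖ ^ 2 = ∫ x in Set.Icc (-1:ℝ) 2, ‖f x‖ ^ 2 := by
    symm
    apply setIntegral_eq_integral_of_forall_compl_eq_zero
    intro x hx
    rw [h0 x hx]; simp
  rw [e]
  calc ∫ x in Set.Icc (-1:ℝ) 2, ‖f x‖ ^ 2 ≤ ∫ x in Set.Icc (-1:ℝ) 2, M ^ 2 := by
        apply setIntegral_mono_on (integrable_sq f).integrableOn (by simp) measurableSet_Icc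
        intro s hs
        exact pow_le_pow_left₀ (norm_nonneg _) (h s hs) 2
    _ = 3 * M ^ 2 := by
        simp; norm_num

lemma low (f : 𝓢(ℝ, ℂ)) (K : ℝ) (hK : 0 < K)
    (h : ∀ s, |s - 1| ≤ 1 / √K → Real.exp (-(4/3)) ≤ ‖f s‖) :
    2 * Real.exp (-(8/3)) / √K ≤ ‖J f‖ ^ 2 := by
  rw [norm_J_sq]
  have hs : 0 < √K := Real.sqrt_pos.2 hK
  calc 2 * Real.exp (-(8/3)) / √K
      = ∫ x in Set.Icc (1 - 1 / √K) (1 + 1 / √K), Real.exp (-(8/3)) := by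
        have : (1 + 1 / √K - (1 - 1 / √K)) = 2 / √K := by ring
        simp only [integral_const, MeasurableSet.univ, measureReal_restrict_apply, Set.univ_inter,
          Real.volume_real_Icc, this]
        rw [max_eq_left (by positivity)]
        simp; ring
    _ ≤ ∫ x in Set.Icc (1 - 1 / √K) (1 + 1 / √K), ‖f x‖ ^ 2 := by
        apply setIntegral_mono_on (by simp) (integrable_sq f).integrableOn measurableSet_Icc
        intro s hs
        have h1 := h s (by rw [abs_le]; constructor <;> linarith [hs.1, hs.2])
        have h2 := pow_le_pow_left₀ (Real.exp_pos _).le h1 2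
        refine le_trans (le_of_eq ?_) h2
        rw [← Real.exp_nat_mul]
        congr 1; norm_num
    _ ≤ _ := by
        apply setIntegral_le_integral (integrable_sq f)
        exact Filter.Eventually.of_forall fun s => by positivity

lemma ratio (f w : 𝓢(ℝ, ℂ)) (K M A B : ℝ) (hA : 0 ≤ A) (hM : 0 ≤ M)  (hB : 0 < B) (hK : 0 < K)
    (hf : ‖J f‖ ^ 2 ≤ M ^ 2 * (A / √K)) (hw : B / √K ≤ ‖J w‖ ^ 2) :
    ‖J f‖ ≤ √(A / B) * M * ‖J w‖ := by
  have hs : 0 < √K := Real.sqrt_pos.2 hK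
  refine (abs_le_of_sq_le_sq' ?_ (by positivity)).2
  rw [mul_pow, mul_pow, Real.sq_sqrt (by positivity)]
  calc ‖J f‖ ^ 2 ≤ M ^ 2 * (A / √K) := hf
    _ = A / B * M ^ 2 * (B / √K) := by field_simp
    _ ≤ _ := by gcongr

end Cub

namespace Cub
open scoped SchwartzMap FourierTransform ENNReal ContDiff

/-- cutoff package -/
lemma cutoff (κ : ℝ) (hκ : 0 < κ) (hκ2 : κ ≤ 1/2) : ∃ (χ χ1 χ2 χ3 : ℝ → ℝ) (B : ℝ), 0 ≤ B ∧
    ContDiff ℝ ∞ χ ∧ ContDiff ℝ ∞ χ1 ∧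
    (∀ s, HasDerivAt χ (χ1 s) s) ∧ (∀ s, HasDerivAt χ1 (χ2 s) s) ∧ (∀ s, HasDerivAt χ2 (χ3 s) s) ∧
    (∀ s, |χ s| ≤ 1) ∧ (∀ s, |χ1 s| ≤ B) ∧ (∀ s, |χ2 s| ≤ B) ∧ (∀ s, |χ3 s| ≤ B) ∧
    (∀ s ∉ Set.Icc (-1:ℝ) 2, χ s = 0 ∧ χ1 s = 0 ∧ χ2 s = 0 ∧ χ3 s = 0) ∧
    (∀ s ∈ Set.Ioo (-1 + κ) (2 - κ), χ s = 1 ∧ χ1 s = 0) := by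
  let b : ContDiffBump (1/2:ℝ) := ⟨3/2 - κ, 3/2, by linarith, by linarith⟩
  have hb : ContDiff ℝ ∞ b := b.contDiff
  have hcs : HasCompactSupport b := b.hasCompactSupport
  have hd : ∀ f : ℝ → ℝ, ContDiff ℝ ∞ f → ContDiff ℝ ∞ (deriv f) := by
    intro f hf
    exact (contDiff_infty_iff_deriv.1 hf).2
  have h1 := hd _ hb
  have h2 := hd _ h1
  have h3 := hd _ h2
  have hD : ∀ f : ℝ → ℝ, ContDiff ℝ ∞ f → ∀ s, HasDerivAt f (deriv f s) s := by
    intro f hf s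
    exact (hf.differentiable (by simp) s).hasDerivAt
  obtain ⟨B1, hB1⟩ := hcs.deriv.exists_bound_of_continuous h1.continuous
  obtain ⟨B2, hB2⟩ := hcs.deriv.deriv.exists_bound_of_continuous h2.continuous
  obtain ⟨B3, hB3⟩ := hcs.deriv.deriv.deriv.exists_bound_of_continuous h3.continuous
  have hB0 : 0 ≤ B1 := (norm_nonneg _).trans (hB1 0)
  have hz : ∀ f : ℝ → ℝ, (∀ s ∉ Set.Icc (-1:ℝ) 2, f s = 0) → ∀ s ∉ Set.Icc (-1:ℝ) 2, deriv f s = 0 := by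
    intro f hf s hs
    have : f =ᶠ[nhds s] fun _ => 0 := by
      filter_upwards [isClosed_Icc.isOpen_compl.mem_nhds hs] with t ht
      exact hf t ht
    rw [this.deriv_eq]; simp
  have hz0 : ∀ s ∉ Set.Icc (-1:ℝ) 2, b s = 0 := by
    intro s hs
    apply b.zero_of_le_dist
    show (3/2:ℝ) ≤ dist s (1/2)
    rw [Real.dist_eq]
    by_contra hlt
    push Not at hlt
    rw [abs_lt] at hlt
    exact hs ⟨by linarith [hlt.1], by linarith [hlt.2]⟩
  have hone : ∀ s ∈ Set.Ioo (-1 + κ) (2 - κ), b s = 1 := by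
    intro s hs
    apply b.one_of_mem_closedBall
    show dist s (1/2) ≤ 3/2 - κ
    rw [Real.dist_eq, abs_le]
    constructor <;> linarith [hs.1, hs.2]
  refine ⟨b, deriv b, deriv (deriv b), deriv (deriv (deriv b)), max B1 (max B2 B3),
    le_max_of_le_left hB0, hb, h1, hD _ hb, hD _ h1, hD _ h2, ?_, ?_, ?_, ?_, ?_, ?_⟩
  · intro s
    rw [abs_of_nonneg b.nonneg]; exact b.le_one
  · intro s; exact (hB1 s).trans (le_max_left _ _)
  · intro s; exact (hB2 s).trans ((le_max_left _ _).trans (le_max_right _ _))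
  · intro s; exact (hB3 s).trans ((le_max_right _ _).trans (le_max_right _ _))
  · intro s hs
    exact ⟨hz0 s hs, hz _ hz0 s hs, hz _ (hz _ hz0) s hs, hz _ (hz _ (hz _ hz0)) s hs⟩
  · intro s hs
    refine ⟨hone s hs, ?_⟩
    have : b =ᶠ[nhds s] fun _ => 1 := by
      filter_upwards [isOpen_Ioo.mem_nhds hs] with t ht
      exact hone t ht
    rw [this.deriv_eq]; simp
end Cub

namespace Cub
open scoped SchwartzMap FourierTransform ENNReal ContDiff

/-- the phase weight -/
noncomputable def Eq (K s : ℝ) : ℝ := Real.exp (-(K * ((s - 1) ^ 2 * (s + 2) / 3)))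

lemma Eq_pos (K s : ℝ) : 0 < Eq K s := Real.exp_pos _

lemma Eq_deriv (K s : ℝ) : HasDerivAt (Eq K) (-(K * (s ^ 2 - 1)) * Eq K s) s := by
  have h0 := hasDerivAt_id s
  have h := (((((h0.sub_const 1).pow 2).mul (h0.add_const 2)).div_const 3).const_mul K).neg.exp
  refine h.congr_deriv ?_
  simp [Eq]; ring

lemma Eq_contDiff (K : ℝ) : ContDiff ℝ ∞ (Eq K) := by
  unfold Eq; fun_prop

lemma mulE {p p' : ℝ → ℝ} (K : ℝ) (h : ∀ s, HasDerivAt p (p' s) s) (s : ℝ) :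
    HasDerivAt (fun s => p s * Eq K s) ((p' s - K * (s ^ 2 - 1) * p s) * Eq K s) s := by
  refine ((h s).mul (Eq_deriv K s)).congr_deriv ?_
  ring

lemma D_eq (f : 𝓢(ℝ, ℂ)) (p p' : ℝ → ℝ) (hf : ∀ s, f s = (p s : ℂ))
    (h : ∀ s, HasDerivAt p (p' s) s) (s : ℝ) : D f s = (p' s : ℂ) := by
  rw [D_apply]
  have : ⇑f = fun s => (p s : ℂ) := funext hf
  rw [this]
  exact (h s).ofReal_comp.deriv

/-- compactly supported smooth real function as Schwartz map -/
noncomputable def mk (f : ℝ → ℝ) (h : ContDiff ℝ ∞ f) (h0 : ∀ s ∉ Set.Icc (-1:ℝ) 2, f s = 0) : 𝓢(ℝ, ℂ) :=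
  HasCompactSupport.toSchwartzMap (f := fun s => (f s : ℂ))
    (HasCompactSupport.intro isCompact_Icc (fun s hs => by rw [h0 s hs]; simp))
    (Complex.ofRealCLM.contDiff.comp h)

lemma mk_apply (f : ℝ → ℝ) (h : ContDiff ℝ ∞ f) (h0 : ∀ s ∉ Set.Icc (-1:ℝ) 2, f s = 0) (s : ℝ) :
    mk f h h0 s = (f s : ℂ) := rfl

lemma p3_bound {K B x y f0 f1 f2 f3 : ℝ} (hB : 0 ≤ B) (hK : 5 ≤ K) (u0 : |f0| ≤ 1) (u1 : |f1| ≤ B)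
    (u2 : |f2| ≤ B) (u3 : |f3| ≤ B) (v1 : |x| ≤ K * 3) (v2 : |y| ≤ K * 4) :
    |f3 - 3 * x * f2 - 3 * y * f1 + 3 * x ^ 2 * f1 + 3 * x * y * f0 - K * 2 * f0 - x ^ 3 * f0| ≤
      (49 * B + 65) * K ^ 3 := by
  have hK0 : 0 < K := by linarith
  have r1 : |3 * x * f2| ≤ 3 * (K * 3) * B := by
    rw [abs_mul, abs_mul, abs_of_pos three_pos]; gcongr
  have r2 : |3 * y * f1| ≤ 3 * (K * 4) * B := by
    rw [abs_mul, abs_mul, abs_of_pos three_pos]; gcongr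
  have r3 : |3 * x ^ 2 * f1| ≤ 3 * (K * 3) ^ 2 * B := by
    rw [abs_mul, abs_mul, abs_of_pos three_pos, abs_pow]; gcongr
  have r4 : |3 * x * y * f0| ≤ 3 * (K * 3) * (K * 4) * 1 := by
    rw [abs_mul, abs_mul, abs_mul, abs_of_pos three_pos]; gcongr
  have r5 : |K * 2 * f0| ≤ K * 2 * 1 := by
    rw [abs_mul, abs_mul, abs_of_pos hK0, abs_of_pos two_pos]; gcongr
  have r6 : |x ^ 3 * f0| ≤ (K * 3) ^ 3 * 1 := by
    rw [abs_mul, abs_pow]; gcongr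
  have k1 : K ≤ K ^ 3 := by nlinarith [pow_le_pow_left₀ (by norm_num) hK 2]
  have k2 : K ^ 2 ≤ K ^ 3 := by nlinarith [pow_le_pow_left₀ (by norm_num) hK 2]
  have k0 : 1 ≤ K ^ 3 := by linarith
  have m1 := mul_le_mul_of_nonneg_left k1 hB
  have m2 := mul_le_mul_of_nonneg_left k2 hB
  have m0 := mul_le_mul_of_nonneg_left k0 hB
  have e1 : (K * 3) ^ 3 * 1 = 27 * K ^ 3 := by ring
  have e2 : 3 * (K * 3) * (K * 4) * 1 = 36 * K ^ 2 := by ring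
  have e3 : 3 * (K * 3) ^ 2 * B = 27 * (B * K ^ 2) := by ring
  have e4 : 3 * (K * 4) * B = 12 * (B * K) := by ring
  have e5 : 3 * (K * 3) * B = 9 * (B * K) := by ring
  rw [e1] at r6
  rw [e2] at r4
  rw [e3] at r3
  rw [e4] at r2
  rw [e5] at r1
  have e6 : (49 * B + 65) * K ^ 3 = 49 * (B * K ^ 3) + 65 * K ^ 3 := by ring
  rw [e6]
  rw [abs_le] at *
  constructor <;> linarith [r1.1, r1.2, r2.1, r2.2, r3.1, r3.2, r4.1, r4.2, r5.1, r5.2, r6.1, r6.2,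
    u3.1, u3.2]

set_option maxHeartbeats 1000000 in
lemma quasi (κ : ℝ) (hκ : 0 < κ) (hκ2 : κ ≤ 1/4) : ∃ C : ℝ, 0 < C ∧ ∀ K : ℝ, 5 ≤ K →
    ∃ w g : 𝓢(ℝ, ℂ), w ≠ 0 ∧ (∀ s : ℝ, D w s = -(K * (s ^ 2 - 1)) * w s + g s) ∧
    ‖J g‖ ≤ C * (K * Real.exp (-((4/3 - 3 * κ) * K))) * ‖J w‖ ∧
    ‖J (D (D w))‖ ≤ C * K * ‖J w‖ ∧ ‖J (D (D (D w)))‖ ≤ C * K ^ 3 * ‖J w‖ := by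
  obtain ⟨χ, χ1, χ2, χ3, B, hB, hc, hc1, hd, hd1, hd2, b0, b1, b2, b3, hz, hone⟩ :=
    cutoff κ hκ (by linarith)
  set c1 := √(√(3 * Real.pi) / (2 * Real.exp (-(8/3)))) with hc1def
  set c2 := √(3 / (2 * Real.exp (-(8/3)))) with hc2def
  refine ⟨c1 * (49 * B + 65) + c2 * B + 1, by positivity, ?_⟩
  intro K hK
  have hK0 : 0 < K := by linarith
  have hsK : 0 < √K := Real.sqrt_pos.2 hK0
  let w := mk (fun s => χ s * Eq K s) (hc.mul (Eq_contDiff K)) (fun s hs => by simp [(hz s hs).1])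
  let g := mk (fun s => χ1 s * Eq K s) (hc1.mul (Eq_contDiff K)) (fun s hs => by simp [(hz s hs).2.1])
  let p1 : ℝ → ℝ := fun s => χ1 s - K * (s ^ 2 - 1) * χ s
  let p1' : ℝ → ℝ := fun s => χ2 s - (K * (2 * s) * χ s + K * (s ^ 2 - 1) * χ1 s)
  let p2 : ℝ → ℝ := fun s => p1' s - K * (s ^ 2 - 1) * p1 s
  have hw : ∀ s, w s = ((χ s * Eq K s : ℝ) : ℂ) := fun s => rfl
  have hg : ∀ s, g s = ((χ1 s * Eq K s : ℝ) : ℂ) := fun s => rfl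
  have hDw : ∀ s, D w s = ((p1 s * Eq K s : ℝ) : ℂ) := D_eq _ _ _ hw (mulE K hd)
  have hq : ∀ s : ℝ, HasDerivAt (fun s => K * (s ^ 2 - 1)) (K * (2 * s)) s := by
    intro s
    refine ((((hasDerivAt_id s).pow 2).sub_const 1).const_mul K).congr_deriv ?_
    simp
  have hp1 : ∀ s, HasDerivAt p1 (p1' s) s := by
    intro s
    exact (hd1 s).sub ((hq s).mul (hd s))
  have hDDw : ∀ s, D (D w) s = ((p2 s * Eq K s : ℝ) : ℂ) := D_eq _ _ _ hDw (mulE K hp1)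
  let p2' : ℝ → ℝ := fun s => (χ3 s - ((K * 2 * χ s + K * (2 * s) * χ1 s) +
    (K * (2 * s) * χ1 s + K * (s ^ 2 - 1) * χ2 s))) - (K * (2 * s) * p1 s + K * (s ^ 2 - 1) * p1' s)
  have hp2 : ∀ s, HasDerivAt p2 (p2' s) s := by
    intro s
    have hq2 : HasDerivAt (fun s => K * (2 * s)) (K * 2) s := by
      refine (((hasDerivAt_id s).const_mul 2).const_mul K).congr_deriv ?_
      simp
    exact ((hd2 s).sub ((hq2.mul (hd s)).add ((hq s).mul (hd1 s)))).sub ((hq s).mul (hp1 s))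
  have hDDDw : ∀ s, D (D (D w)) s = (((p2' s - K * (s ^ 2 - 1) * p2 s) * Eq K s : ℝ) : ℂ) :=
    D_eq _ _ _ hDDw (mulE K hp2)
  have hlow : 2 * Real.exp (-(8/3)) / √K ≤ ‖J w‖ ^ 2 := by
    apply low _ _ hK0
    intro s hs
    have h2 : 2 ≤ √K := by
      apply Real.le_sqrt_of_sq_le; linarith
    have h1 : 1 / √K ≤ 1 / 2 := by gcongr
    have hs2 := abs_le.1 (hs.trans h1)
    have hsq : K * (s - 1) ^ 2 ≤ 1 := by
      have := pow_le_pow_left₀ (abs_nonneg _) hs 2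
      rw [sq_abs, div_pow, Real.sq_sqrt hK0.le] at this
      rw [le_div_iff₀ hK0] at this
      linarith
    rw [hw, (hone s ⟨by linarith, by linarith⟩).1, one_mul, Complex.norm_real,
      Real.norm_of_nonneg (Eq_pos K s).le]
    apply Real.exp_le_exp.2
    nlinarith [sq_nonneg (s - 1)]
  have hKs : ∀ s ∈ Set.Icc (-1:ℝ) 2, Eq K s ≤ Real.exp (-(K * (s - 1) ^ 2 / 6)) := by
    intro s hs
    apply Real.exp_le_exp.2
    have : 0 ≤ K * (s - 1) ^ 2 := by positivity
    nlinarith [hs.1]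
  have hq1 : ∀ s ∈ Set.Icc (-1:ℝ) 2, |s ^ 2 - 1| ≤ 3 := by
    intro s hs
    rw [abs_le]; constructor <;> nlinarith [hs.1, hs.2]
  have hs2 : ∀ s ∈ Set.Icc (-1:ℝ) 2, |s| ≤ 2 := by
    intro s hs
    rw [abs_le]; constructor <;> linarith [hs.1, hs.2]
  refine ⟨w, g, ?_, ?_, ?_, ?_, ?_⟩
  · intro h
    rw [h, map_zero, norm_zero] at hlow
    have : 0 < 2 * Real.exp (-(8/3)) / √K := by positivity
    norm_num at hlow
    linarith
  · intro s
    rw [hDw, hw, hg]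
    simp only [p1]; push_cast; ring
  · have h1 : ‖J g‖ ^ 2 ≤ 3 * (B * Real.exp (-((4/3 - 3 * κ) * K))) ^ 2 := by
      apply box_up
      · intro s hs
        rw [hg, Complex.norm_real, norm_mul, Real.norm_of_nonneg (Eq_pos K s).le, Real.norm_eq_abs]
        by_cases hin : s ∈ Set.Ioo (-1 + κ) (2 - κ)
        · rw [(hone s hin).2]; simp; positivity
        · refine mul_le_mul (b1 s) ?_ (Eq_pos K s).le hB
          apply Real.exp_le_exp.2
          have : 4/3 - 3 * κ ≤ (s - 1) ^ 2 * (s + 2) / 3 := by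
            rw [Set.mem_Ioo, not_and_or, not_lt, not_lt] at hin
            rcases hin with hin | hin
            · have h5 : (2 - κ) ^ 2 ≤ (s - 1) ^ 2 := by nlinarith
              have h6 := mul_le_mul h5 (show 1 ≤ s + 2 by linarith [hs.1]) zero_le_one (by positivity)
              nlinarith
            · have h5 : (1 - κ) ^ 2 ≤ (s - 1) ^ 2 := by nlinarith
              have h6 := mul_le_mul h5 (show 4 - κ ≤ s + 2 by linarith [hs.1]) (by linarith) (by positivity)
              have h7 : 0 ≤ κ ^ 2 * (6 - κ) := mul_nonneg (sq_nonneg κ) (by linarith)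
              nlinarith
          have := mul_le_mul_of_nonneg_left this hK0.le
          linarith
      · intro s hs
        rw [hg, (hz s hs).2.1]; simp
    have h2 : ‖J g‖ ^ 2 ≤ (B * (K * Real.exp (-((4/3 - 3 * κ) * K)))) ^ 2 * (3 / √K) := by
      refine h1.trans ?_
      have : 1 ≤ K ^ 2 / √K := by
        rw [le_div_iff₀ hsK, one_mul, Real.sqrt_le_left (by positivity)]
        nlinarith [pow_le_pow_left₀ (by norm_num) hK 2]
      have e : (B * (K * Real.exp (-((4/3 - 3 * κ) * K)))) ^ 2 * (3 / √K) =
        (K ^ 2 / √K) * (3 * (B * Real.exp (-((4/3 - 3 * κ) * K))) ^ 2) := by ring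
      rw [e]
      exact le_mul_of_one_le_left (by positivity) this
    have h3 := ratio g w K _ _ _ (by norm_num) (by positivity) (by positivity) hK0 h2 hlow
    refine h3.trans ?_
    rw [← hc2def]
    have e : c2 * (B * (K * Real.exp (-((4/3 - 3 * κ) * K)))) * ‖J w‖ =
      (c2 * B) * ((K * Real.exp (-((4/3 - 3 * κ) * K))) * ‖J w‖) := by ring
    rw [e, mul_assoc (c1 * (49 * B + 65) + c2 * B + 1)]
    gcongr
    have : 0 ≤ c1 * (49 * B + 65) := by positivity
    linarith
  · have h1 : ∀ s, ‖D (D w) s‖ ≤ ((49 * B + 65) * K) * Real.exp (-(K * (s - 1) ^ 2 / 6)) := by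
      intro s
      by_cases hs : s ∈ Set.Icc (-1:ℝ) 2
      swap
      · obtain ⟨z0, z1, z2, z3⟩ := hz s hs
        rw [hDDw]; simp only [p2, p1', p1, z0, z1, z2]; simp; positivity
      rw [hDDw, Complex.norm_real, norm_mul, Real.norm_of_nonneg (Eq_pos K s).le, Real.norm_eq_abs]
      have hkey : K * (s ^ 2 - 1) ^ 2 * Eq K s ≤ 54 * Real.exp (-(K * (s - 1) ^ 2 / 6)) := by
        set t := K * ((s - 1) ^ 2 * (s + 2) / 3) with ht
        have ht1 : K * (s ^ 2 - 1) ^ 2 ≤ 27 * t := by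
          have : (s + 1) ^ 2 ≤ 9 * (s + 2) := by nlinarith [hs.1, hs.2]
          have h7 := mul_le_mul_of_nonneg_left this (show 0 ≤ K * (s - 1) ^ 2 by positivity)
          rw [ht]; nlinarith
        have ht2 : t ≤ 2 * Real.exp (t / 2) := by
          have := Real.add_one_le_exp (t / 2); linarith
        have ht3 : Real.exp (-(t / 2)) ≤ Real.exp (-(K * (s - 1) ^ 2 / 6)) := by
          apply Real.exp_le_exp.2
          have : 0 ≤ K * (s - 1) ^ 2 := by positivity
          rw [ht]; nlinarith [hs.1]
        have e : Eq K s = Real.exp (-(t / 2)) * Real.exp (-(t / 2)) := by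
          rw [← Real.exp_add, Eq]; congr 1; ring
        have hpos := Real.exp_pos (-(t / 2))
        calc K * (s ^ 2 - 1) ^ 2 * Eq K s ≤ 27 * t * Eq K s := by
              have := (Eq_pos K s).le; gcongr
          _ ≤ 27 * (2 * Real.exp (t / 2)) * Eq K s := by
              have := (Eq_pos K s).le; gcongr
          _ = 54 * Real.exp (-(t / 2)) := by
              rw [e]
              have : Real.exp (t / 2) * Real.exp (-(t / 2)) = 1 := by rw [← Real.exp_add]; simp
              linear_combination 54 * Real.exp (-(t / 2)) * this
          _ ≤ _ := by linarith
      have e : p2 s = (χ2 s - K * (2 * s) * χ s - 2 * (K * (s ^ 2 - 1)) * χ1 s) + 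
          K * (K * (s ^ 2 - 1) ^ 2) * χ s := by simp only [p2, p1', p1]; ring
      have hA : |χ2 s - K * (2 * s) * χ s - 2 * (K * (s ^ 2 - 1)) * χ1 s| ≤ (7 * B + 4) * K := by
        have t1 : |K * (2 * s) * χ s| ≤ K * (2 * 2) * 1 := by
          rw [abs_mul, abs_mul, abs_mul, abs_of_pos hK0, abs_of_pos (two_pos)]
          have := hs2 s hs
          have := b0 s
          gcongr
        have t2 : |2 * (K * (s ^ 2 - 1)) * χ1 s| ≤ 2 * (K * 3) * B := by
          rw [abs_mul, abs_mul, abs_mul, abs_of_pos hK0, abs_of_pos (two_pos)]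
          have := hq1 s hs
          have := b1 s
          gcongr
        have t3 := b2 s
        have t4 := abs_sub (χ2 s - K * (2 * s) * χ s) (2 * (K * (s ^ 2 - 1)) * χ1 s)
        have t5 := abs_sub (χ2 s) (K * (2 * s) * χ s)
        nlinarith
      have hE := hKs s hs
      have hE0 := (Eq_pos K s)
      calc |p2 s| * Eq K s ≤ ((7 * B + 4) * K + K * (K * (s ^ 2 - 1) ^ 2)) * Eq K s := by
            gcongr
            rw [e]
            refine (abs_add_le _ _).trans ?_
            gcongr
            rw [abs_mul, abs_of_nonneg (by positivity)]
            exact mul_le_of_le_one_right (by positivity) (b0 s)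
        _ = (7 * B + 4) * K * Eq K s + K * (K * (s ^ 2 - 1) ^ 2 * Eq K s) := by ring
        _ ≤ (7 * B + 4) * K * Real.exp (-(K * (s - 1) ^ 2 / 6)) + K * (54 * Real.exp (-(K * (s - 1) ^ 2 / 6))) := by
            gcongr
        _ ≤ _ := by
            have : 0 ≤ K * Real.exp (-(K * (s - 1) ^ 2 / 6)) := by positivity
            nlinarith [mul_nonneg hB this]
    have h2 := gauss_up _ _ K hK0 h1
    have h3 := ratio _ w K _ _ _ (by positivity) (by positivity) (by positivity) hK0 h2 hlow
    refine h3.trans ?_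
    rw [← hc1def]
    have e : c1 * ((49 * B + 65) * K) * ‖J w‖ = c1 * (49 * B + 65) * (K * ‖J w‖) := by ring
    rw [e, mul_assoc (c1 * (49 * B + 65) + c2 * B + 1)]
    gcongr
    have : 0 ≤ c2 * B := by positivity
    linarith
  · have h1 : ∀ s, ‖D (D (D w)) s‖ ≤ ((49 * B + 65) * K ^ 3) * Real.exp (-(K * (s - 1) ^ 2 / 6)) := by
      intro s
      by_cases hs : s ∈ Set.Icc (-1:ℝ) 2
      swap
      · obtain ⟨z0, z1, z2, z3⟩ := hz s hs
        rw [hDDDw]; simp only [p2', p2, p1', p1, z0, z1, z2, z3]; simp; positivity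
      rw [hDDDw, Complex.norm_real, norm_mul, Real.norm_of_nonneg (Eq_pos K s).le, Real.norm_eq_abs]
      have hE := hKs s hs
      have hE0 := (Eq_pos K s)
      refine mul_le_mul ?_ hE hE0.le (by positivity)
      have e : p2' s - K * (s ^ 2 - 1) * p2 s = χ3 s - 3 * (K * (s ^ 2 - 1)) * χ2 s
          - 3 * (K * (2 * s)) * χ1 s + 3 * (K * (s ^ 2 - 1)) ^ 2 * χ1 s
          + 3 * (K * (s ^ 2 - 1)) * (K * (2 * s)) * χ s - K * 2 * χ s
          - (K * (s ^ 2 - 1)) ^ 3 * χ s := by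
        simp only [p2', p2, p1', p1]; ring
      rw [e]
      have u0 := b0 s
      have u1 := b1 s
      have u2 := b2 s
      have u3 := b3 s
      have v1 : |K * (s ^ 2 - 1)| ≤ K * 3 := by
        rw [abs_mul, abs_of_pos hK0]; have := hq1 s hs; gcongr
      have v2 : |K * (2 * s)| ≤ K * 4 := by
        rw [abs_mul, abs_of_pos hK0, abs_mul, abs_of_pos two_pos]
        have := hs2 s hs
        have : 2 * |s| ≤ 4 := by linarith
        gcongr
      exact p3_bound hB hK u0 u1 u2 u3 v1 v2
    have h2 := gauss_up _ _ K hK0 h1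
    have h3 := ratio _ w K _ _ _ (by positivity) (by positivity) (by positivity) hK0 h2 hlow
    refine h3.trans ?_
    rw [← hc1def]
    have e : c1 * ((49 * B + 65) * K ^ 3) * ‖J w‖ = c1 * (49 * B + 65) * (K ^ 3 * ‖J w‖) := by ring
    rw [e, mul_assoc (c1 * (49 * B + 65) + c2 * B + 1)]
    gcongr
    have : 0 ≤ c2 * B := by positivity
    linarith
end Cub

namespace Cub
open scoped SchwartzMap FourierTransform ENNReal ContDiff

lemma B1_quant (κ : ℝ) (hκ : 0 < κ) (hκ2 : κ ≤ 1/4) : ∃ C : ℝ, 0 < C ∧ ∀ a k K : ℝ, 0 < a → 0 < k →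
    5 ≤ K → K = k ^ 3 / (3 * a ^ 2) → mP (((k ^ 2 : ℝ) : ℂ) + a ^ 3 * I) ≤
      C * (3 * a ^ 2 / k * (K * Real.exp (-((4/3 - 3 * κ) * K))) + k / a + k ^ 6 / a ^ 6) := by
  obtain ⟨C, hC, h⟩ := quasi κ hκ hκ2
  refine ⟨C, hC, ?_⟩
  intro a k K ha hk hK hKe
  obtain ⟨w, g, hw, hD, h1, h2, h3⟩ := h K hK
  have hac : (a : ℂ) ≠ 0 := by exact_mod_cast ha.ne'
  have hkc : (k : ℂ) ≠ 0 := by exact_mod_cast hk.ne'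
  have hKc : (K : ℂ) = k ^ 3 / (3 * a ^ 2) := by rw [hKe]; push_cast; ring
  have e : OpF a (k ^ 2) k w = (3 * a ^ 2 / k : ℂ) • g - (3 * I * a / k ^ 2 : ℂ) • D (D w)
      - (1 / k ^ 3 : ℂ) • D (D (D w)) := by
    ext s
    have := hD s
    simp only [OpF, SchwartzMap.sub_apply, SchwartzMap.add_apply, SchwartzMap.smul_apply, this,
      X_apply, smul_eq_mul, hKc]
    push_cast
    field_simp
    ring
  refine (mP_fourier a (k ^ 2) k hk w hw).trans ?_
  have hJ := J_pos w hw
  rw [div_le_iff₀ hJ, e]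
  have n1 : ‖(3 * a ^ 2 / k : ℂ)‖ = 3 * a ^ 2 / k := by
    simp [abs_of_pos hk]
  have n2 : ‖(3 * I * a / k ^ 2 : ℂ)‖ = 3 * a / k ^ 2 := by
    simp [abs_of_pos ha]
  have n3 : ‖(1 / k ^ 3 : ℂ)‖ = 1 / k ^ 3 := by
    simp [abs_of_pos hk]
  rw [map_sub, map_sub, map_smul, map_smul, map_smul]
  refine (norm_sub_le _ _).trans ((add_le_add (norm_sub_le _ _) le_rfl).trans ?_)
  rw [norm_smul, norm_smul, norm_smul, n1, n2, n3]
  calc 3 * a ^ 2 / k * ‖J g‖ + 3 * a / k ^ 2 * ‖J (D (D w))‖ + 1 / k ^ 3 * ‖J (D (D (D w)))‖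
      ≤ 3 * a ^ 2 / k * (C * (K * Real.exp (-((4/3 - 3 * κ) * K))) * ‖J w‖)
        + 3 * a / k ^ 2 * (C * K * ‖J w‖) + 1 / k ^ 3 * (C * K ^ 3 * ‖J w‖) := by gcongr
    _ = C * (3 * a ^ 2 / k * (K * Real.exp (-((4/3 - 3 * κ) * K))) + 3 * a / k ^ 2 * K
          + 1 / k ^ 3 * K ^ 3) * ‖J w‖ := by ring
    _ ≤ _ := by
        have e1 : 3 * a / k ^ 2 * K = k / a := by rw [hKe]; field_simp
        have e2 : 1 / k ^ 3 * K ^ 3 ≤ k ^ 6 / a ^ 6 := by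
          have : 1 / k ^ 3 * K ^ 3 = k ^ 6 / a ^ 6 * (1 / 27) := by rw [hKe]; field_simp; norm_num
          rw [this]
          have : 0 ≤ k ^ 6 / a ^ 6 := by positivity
          linarith
        rw [e1]
        gcongr

set_option maxHeartbeats 3200000 in
lemma partB1 (δ ε : ℝ) (hδ : 0 < δ) (hε : 0 < ε) :
    ∀ᶠ y : ℝ in Filter.atTop, ∀ z : ℂ, z.im = y → (1 + δ) * Lam y ≤ z.re → z.re ≤ y ^ ((3:ℝ)/5) →
      mP z < ε := by
  set κ := δ / (12 * (1 + δ)) with hκ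
  have hκ0 : 0 < κ := by positivity
  have hκ1 : (1 - 3 * κ) * (1 + δ) = 1 + 3 / 4 * δ := by rw [hκ]; field_simp; ring
  have hκ2 : κ ≤ 1 / 4 := by
    rw [hκ, div_le_iff₀ (by positivity)]; linarith
  obtain ⟨C, hC, hB⟩ := B1_quant κ hκ0 hκ2
  set θ := (1 + δ) ^ ((1:ℝ)/2) with hθ
  have hθ1 : 1 < θ := Real.one_lt_rpow (by linarith) (by norm_num)
  have hθ2 : (1 + δ) ^ ((3:ℝ)/2) = (1 + δ) * θ := by
    rw [hθ]
    nth_rewrite 2 [← Real.rpow_one (1 + δ)]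
    rw [← Real.rpow_add (by linarith)]; norm_num
  have ht : Filter.Tendsto (fun y : ℝ => C * (3 / κ * y ^ (-(4 / 9 * (θ - 1))) + y ^ (-(1/30:ℝ))
      + y ^ (-(1/5:ℝ)))) Filter.atTop (nhds 0) := by
    have t1 := (tendsto_rpow_neg_atTop (y := 4 / 9 * (θ - 1)) (by linarith)).const_mul (3 / κ)
    have t2 := tendsto_rpow_neg_atTop (y := (1/30:ℝ)) (by norm_num)
    have t3 := tendsto_rpow_neg_atTop (y := (1/5:ℝ)) (by norm_num)
    have := ((t1.add t2).add t3).const_mul C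
    simpa using this
  filter_upwards [ht.eventually (gt_mem_nhds hε), Filter.eventually_ge_atTop 3,
    Real.tendsto_log_atTop.eventually_ge_atTop 15] with y h1 h3 hlog15 z hz hle hup
  have hy0 : (0:ℝ) < y := by linarith
  have hlog1 : 1 ≤ Real.log y := by linarith
  have hlog0 : 0 < Real.log y := by linarith
  have hL : y ^ ((4:ℝ)/9) ≤ Lam y := by
    unfold Lam
    apply le_mul_of_one_le_right (by positivity)
    exact Real.one_le_rpow hlog1 (by norm_num)
  have hL0 : 0 < Lam y := lt_of_lt_of_le (by positivity) hL
  have hd2 : 0 < 1 + δ := by linarith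
  set a := y ^ ((1:ℝ)/3) with ha
  have ha0 : 0 < a := by positivity
  have ha2 : a ^ 2 = y ^ ((2:ℝ)/3) := by
    rw [ha, ← Real.rpow_natCast, ← Real.rpow_mul hy0.le]; norm_num
  have ha3 : a ^ 3 = y := by
    rw [ha, ← Real.rpow_natCast, ← Real.rpow_mul hy0.le]; norm_num
  set p := (1 + δ) ^ ((1:ℝ)/2) * y ^ ((2:ℝ)/9) * (Real.log y) ^ ((1:ℝ)/3) with hp
  have hp0 : 0 < p := by positivity
  have hp2 : p ^ 2 = (1 + δ) * Lam y := by
    rw [hp, mul_pow, mul_pow, ← Real.rpow_natCast, ← Real.rpow_mul hd2.le, ← Real.rpow_natCast,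
      ← Real.rpow_mul hy0.le, ← Real.rpow_natCast, ← Real.rpow_mul hlog0.le, Lam]
    norm_num; ring
  have hp3 : p ^ 3 = (1 + δ) * θ * (a ^ 2 * Real.log y) := by
    rw [← hθ2, ha2, hp, mul_pow, mul_pow, ← Real.rpow_natCast, ← Real.rpow_mul hd2.le, ← Real.rpow_natCast,
      ← Real.rpow_mul hy0.le, ← Real.rpow_natCast, ← Real.rpow_mul hlog0.le]
    norm_num; ring
  set k := √z.re with hk
  have hre0 : 0 < z.re := lt_of_lt_of_le (by positivity) hle
  have hk0 : 0 < k := Real.sqrt_pos.2 hre0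
  have hk2 : k ^ 2 = z.re := Real.sq_sqrt hre0.le
  have hpk : p ≤ k := Real.le_sqrt_of_sq_le (by rw [hp2]; exact hle)
  set K := k ^ 3 / (3 * a ^ 2) with hK
  have hKlow : (1 + δ) * θ * Real.log y / 3 ≤ K := by
    rw [hK, le_div_iff₀ (by positivity)]
    have := pow_le_pow_left₀ hp0.le hpk 3
    rw [hp3] at this
    linarith
  have hdt : 1 ≤ (1 + δ) * θ := by nlinarith
  have hK5 : 5 ≤ K := by nlinarith
  have key := hB a k K ha0 hk0 hK5 rfl
  have hz' : ((k ^ 2 : ℝ) : ℂ) + a ^ 3 * I = z := by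
    rw [hk2, ← Complex.ofReal_pow, ha3, ← hz, Complex.re_add_im]
  rw [hz'] at key
  refine lt_of_le_of_lt (key.trans ?_) h1
  have hylow : y ^ ((2:ℝ)/9) ≤ k := by
    apply Real.le_sqrt_of_sq_le
    have e : (y ^ ((2:ℝ)/9)) ^ 2 = y ^ ((4:ℝ)/9) := by
      rw [← Real.rpow_natCast, ← Real.rpow_mul hy0.le]; congr 1; norm_num
    rw [e]
    have e2 : Lam y ≤ (1 + δ) * Lam y := le_mul_of_one_le_left hL0.le (by linarith)
    exact hL.trans (e2.trans hle)
  have hyup : k ≤ y ^ ((3:ℝ)/10) := by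
    rw [hk, Real.sqrt_le_left (by positivity), ← Real.rpow_natCast, ← Real.rpow_mul hy0.le]
    norm_num
    linarith
  gcongr ?_ * (?_ + ?_ + ?_)
  · have s1 : 3 * a ^ 2 / k ≤ 3 * y ^ ((4:ℝ)/9) := by
      rw [div_le_iff₀ hk0, ha2]
      have : y ^ ((2:ℝ)/3) = y ^ ((4:ℝ)/9) * y ^ ((2:ℝ)/9) := by
        rw [← Real.rpow_add hy0]; norm_num
      rw [this, ← mul_assoc]
      gcongr
    have s2 : K * Real.exp (-((4/3 - 3 * κ) * K)) ≤ 1 / κ * y ^ (-(4 / 9 * θ)) := by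
      have e1 : Real.exp (-((4/3 - 3 * κ) * K)) = Real.exp (-(κ * K)) * Real.exp (-(4/3 * (1 - 3 * κ) * K)) := by
        rw [← Real.exp_add]; congr 1; ring
      have e2 : K * Real.exp (-(κ * K)) ≤ 1 / κ := by
        rw [Real.exp_neg, ← div_eq_mul_inv, div_le_div_iff₀ (Real.exp_pos _) hκ0]
        have := Real.add_one_le_exp (κ * K)
        linarith
      have e3 : Real.exp (-(4/3 * (1 - 3 * κ) * K)) ≤ y ^ (-(4 / 9 * θ)) := by
        rw [Real.rpow_def_of_pos hy0]
        apply Real.exp_le_exp.2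
        have h5 : 0 ≤ 1 - 3 * κ := by linarith
        have h6 := mul_le_mul_of_nonneg_left hKlow h5
        have h7 : (1 - 3 * κ) * ((1 + δ) * θ * Real.log y / 3) = (1 + 3 / 4 * δ) * (θ * Real.log y / 3) := by
          rw [← hκ1]; ring
        rw [h7] at h6
        have h8 : 0 ≤ δ * (θ * Real.log y / 3) := by positivity
        nlinarith
      rw [e1, ← mul_assoc]
      exact mul_le_mul e2 e3 (Real.exp_pos _).le (by positivity)
    calc 3 * a ^ 2 / k * (K * Real.exp (-((4/3 - 3 * κ) * K))) ≤
        3 * y ^ ((4:ℝ)/9) * (1 / κ * y ^ (-(4 / 9 * θ))) := by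
          have : 0 < K := by linarith
          gcongr
      _ = 3 / κ * (y ^ ((4:ℝ)/9) * y ^ (-(4 / 9 * θ))) := by ring
      _ = _ := by rw [← Real.rpow_add hy0]; ring_nf
  · rw [div_le_iff₀ ha0, ha, ← Real.rpow_add hy0]
    refine hyup.trans (le_of_eq ?_); norm_num
  · have e1 : k ^ 6 ≤ (y ^ ((3:ℝ)/10)) ^ 6 := by gcongr
    have e2 : a ^ 6 = y ^ 2 := by rw [← ha3]; ring
    rw [e2, div_le_iff₀ (by positivity), ← Real.rpow_natCast y 2, ← Real.rpow_add hy0]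
    refine e1.trans (le_of_eq ?_)
    rw [← Real.rpow_natCast, ← Real.rpow_mul hy0.le]; norm_num
end Cub

namespace Cub
open scoped SchwartzMap FourierTransform ENNReal ContDiff

lemma memLp_g : MemLp (fun x : ℝ => (1 + x ^ 2)⁻¹) 2 (volume : Measure ℝ) := by
  have hc : Continuous (fun x : ℝ => (1 + x ^ 2)⁻¹) := by
    apply Continuous.inv₀ (by fun_prop)
    intro x; positivity
  rw [memLp_two_iff_integrable_sq hc.aestronglyMeasurable]
  refine integrable_inv_one_add_sq.mono' (hc.pow 2).aestronglyMeasurable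
    (Filter.Eventually.of_forall fun x => ?_)
  have h1 : (0:ℝ) < 1 + x ^ 2 := by positivity
  have h2 : (1 + x ^ 2)⁻¹ ≤ 1 := by
    apply inv_le_one_of_one_le₀; nlinarith [sq_nonneg x]
  have h3 : 0 < (1 + x ^ 2)⁻¹ := by positivity
  rw [Real.norm_of_nonneg (by positivity)]
  nlinarith

/-- quasimode from a globally defined WKB function -/
lemma gen (z : ℂ) (u s s' : ℝ → ℂ) (η C : ℝ) (hη : 0 ≤ η) (hC : 0 ≤ C) (hu0 : ∀ x, u x ≠ 0)
    (husm : ContDiff ℝ ∞ u) (hu : ∀ x, HasDerivAt u (-(s x) * u x) x)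
    (hs : ∀ x, HasDerivAt s (s' x) x)
    (hE : ∀ x : ℝ, ‖s' x - s x ^ 2 - (z - I * x ^ 3)‖ ≤ η)
    (hb : ∀ x, ‖u x‖ ≤ C * (1 + x ^ 2)⁻¹) (hb2 : ∀ x, ‖s x‖ * ‖u x‖ ≤ C * (1 + x ^ 2)⁻¹) :
    mP z ≤ η := by
  obtain ⟨χ, χ1, χ2, χ3, B, hB, hc, hc1, hd, hd1, hd2, b0, b1, b2, b3, hz, hone⟩ :=
    cutoff (1/4) (by norm_num) (by norm_num)
  -- lower bound
  obtain ⟨x0, hx0, hmin⟩ := isCompact_Icc.exists_isMinOn (s := Set.Icc (-(1/2):ℝ) (1/2))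
    ⟨0, by norm_num⟩ (husm.continuous.norm.continuousOn)
  set c := ‖u x0‖ with hcdef
  have hc0 : 0 < c := norm_pos_iff.2 (hu0 x0)
  set G := (eLpNorm (fun x : ℝ => (1 + x ^ 2)⁻¹) 2 (volume : Measure ℝ)).toReal with hG
  have key : ∀ N : ℝ, 1 ≤ N → mP z ≤ η + (3 * B * C / N) * G / c := by
    intro N hN
    have hN0 : 0 < N := by linarith
    have hdiv : ∀ x : ℝ, HasDerivAt (fun x : ℝ => x / N) (1 / N) x := fun x =>
      (hasDerivAt_id x).div_const N
    let f : ℝ → ℂ := fun x => (χ (x / N) : ℂ) * u x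
    have hfs : ContDiff ℝ ∞ f := by
      apply ContDiff.mul _ husm
      exact Complex.ofRealCLM.contDiff.comp (hc.comp (by fun_prop))
    have hfc : HasCompactSupport f := by
      refine HasCompactSupport.intro (K := Set.Icc (-N) (2 * N)) isCompact_Icc (fun x hx => ?_)
      have : x / N ∉ Set.Icc (-1:ℝ) 2 := by
        intro h
        apply hx
        have h1 := h.1
        have h2 := h.2
        rw [le_div_iff₀ hN0] at h1
        rw [div_le_iff₀ hN0] at h2
        exact ⟨by linarith, h2⟩
      simp [f, (hz _ this).1]
    let F : 𝓢(ℝ, ℂ) := hfc.toSchwartzMap hfs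
    have hF : ⇑F = f := rfl
    have k1 : ∀ x, HasDerivAt (fun x : ℝ => (χ (x / N) : ℂ)) ((χ1 (x / N) / N : ℝ) : ℂ) x := by
      intro x
      have := ((hd (x / N)).comp x (hdiv x)).ofReal_comp
      refine this.congr_deriv ?_
      push_cast; ring
    have k2 : ∀ x, HasDerivAt (fun x : ℝ => ((χ1 (x / N) / N : ℝ) : ℂ)) ((χ2 (x / N) / N / N : ℝ) : ℂ) x := by
      intro x
      have := (((hd1 (x / N)).comp x (hdiv x)).div_const N).ofReal_comp
      refine this.congr_deriv ?_
      push_cast; ring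
    have d1 : deriv f = fun x => ((χ1 (x / N) / N : ℝ) : ℂ) * u x - (χ (x / N) : ℂ) * (s x * u x) := by
      ext x
      refine (HasDerivAt.deriv (f := f) ((k1 x).mul (hu x))).trans ?_
      ring
    have d2 : ∀ x, deriv (deriv f) x = ((χ2 (x / N) / N / N : ℝ) : ℂ) * u x -
        2 * (((χ1 (x / N) / N : ℝ) : ℂ) * (s x * u x)) - (χ (x / N) : ℂ) * (s' x * u x - s x ^ 2 * u x) := by
      intro x
      rw [d1]
      refine (HasDerivAt.deriv (f := fun x => ((χ1 (x / N) / N : ℝ) : ℂ) * u x - (χ (x / N) : ℂ) * (s x * u x))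
        (((k2 x).mul (hu x)).sub ((k1 x).mul ((hs x).mul (hu x))))).trans ?_
      ring
    have hOp : ∀ x, Op z F x = (s' x - s x ^ 2 - (z - I * x ^ 3)) * f x +
        (2 * (((χ1 (x / N) / N : ℝ) : ℂ) * (s x * u x)) - ((χ2 (x / N) / N / N : ℝ) : ℂ) * u x) := by
      intro x
      rw [Op_coe]
      simp only [hF]
      rw [d2]
      simp only [f]; ring
    have hle : ∀ x, ‖Op z F x‖ ≤ η * ‖F x‖ + (3 * B * C / N) * (1 + x ^ 2)⁻¹ := by
      intro x
      rw [hOp]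
      have p1 : ‖(s' x - s x ^ 2 - (z - I * x ^ 3)) * f x‖ ≤ η * ‖F x‖ := by
        rw [norm_mul, hF]
        exact mul_le_mul_of_nonneg_right (hE x) (norm_nonneg _)
      have q1 : |χ1 (x / N)| / N ≤ B / N := by gcongr; exact b1 _
      have q2 : |χ2 (x / N)| / N / N ≤ B / N := by
        rw [div_le_iff₀ hN0]
        have : B / N * N = B := by field_simp
        rw [this]
        rw [div_le_iff₀ hN0]
        have := b2 (x / N)
        nlinarith
      have p2 : ‖2 * (((χ1 (x / N) / N : ℝ) : ℂ) * (s x * u x))‖ ≤ 2 * (B / N * (C * (1 + x ^ 2)⁻¹)) := by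
        rw [norm_mul, norm_mul, Complex.norm_real, Real.norm_eq_abs, abs_div, abs_of_pos hN0,
          norm_mul (s x), Complex.norm_ofNat]
        have := hb2 x
        gcongr
      have p3 : ‖((χ2 (x / N) / N / N : ℝ) : ℂ) * u x‖ ≤ B / N * (C * (1 + x ^ 2)⁻¹) := by
        rw [norm_mul, Complex.norm_real, Real.norm_eq_abs, abs_div, abs_div, abs_of_pos hN0]
        have := hb x
        gcongr
      have e : (3 * B * C / N) * (1 + x ^ 2)⁻¹ = 2 * (B / N * (C * (1 + x ^ 2)⁻¹)) + B / N * (C * (1 + x ^ 2)⁻¹) := by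
        ring
      rw [e]
      refine (norm_add_le _ _).trans (add_le_add p1 ((norm_sub_le _ _).trans (add_le_add p2 p3)))
    have hlow : c ≤ ‖J F‖ := by
      have hsq : c ^ 2 ≤ ‖J F‖ ^ 2 := by
        rw [norm_J_sq]
        calc c ^ 2 = ∫ x in Set.Icc (-(1/2):ℝ) (1/2), c ^ 2 := by simp; norm_num
          _ ≤ ∫ x in Set.Icc (-(1/2):ℝ) (1/2), ‖F x‖ ^ 2 := by
            apply setIntegral_mono_on (by simp) (integrable_sq F).integrableOn measurableSet_Icc
            intro x hx
            have hx1 : x / N ∈ Set.Ioo (-1 + 1/4:ℝ) (2 - 1/4) := by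
              have h1 := hx.1
              have h2 := hx.2
              constructor
              · rw [lt_div_iff₀ hN0]; linarith
              · rw [div_lt_iff₀ hN0]; linarith
            have : F x = u x := by
              rw [hF]; simp [f, (hone _ hx1).1]
            rw [this]
            have := hmin hx
            simp only [Set.mem_setOf_eq] at this
            gcongr
          _ ≤ ∫ x, ‖F x‖ ^ 2 := setIntegral_le_integral (integrable_sq F)
              (Filter.Eventually.of_forall fun x => by positivity)
      exact (sq_le_sq₀ hc0.le (norm_nonneg _)).1 hsq
    have hFne : F ≠ 0 := by
      intro h
      rw [h, map_zero, norm_zero] at hlow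
      linarith
    have hnorm : ‖J (Op z F)‖ ≤ η * ‖J F‖ + (3 * B * C / N) * G := by
      have mF : MemLp (fun x => ‖F x‖) 2 (volume : Measure ℝ) := (F.memLp 2 volume).norm
      have m1 := mF.const_mul η
      have m2 := memLp_g.const_mul (3 * B * C / N)
      have i1 := eLpNorm_mono_real (p := 2) (μ := volume) hle
      have i2 := i1.trans (eLpNorm_add_le m1.1 m2.1 (by norm_num))
      have i3 := ENNReal.toReal_mono (ENNReal.add_ne_top.2 ⟨m1.2.ne, m2.2.ne⟩) i2
      rw [ENNReal.toReal_add m1.2.ne m2.2.ne] at i3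
      rw [norm_J, norm_J]
      refine i3.trans (le_of_eq ?_)
      have j1 : (eLpNorm (fun x => η * ‖F x‖) 2 volume).toReal = η * (eLpNorm F 2 volume).toReal := by
        have := eLpNorm_const_smul η (fun x => ‖F x‖) 2 (volume : Measure ℝ)
        have e : (η • fun x => ‖F x‖) = fun x => η * ‖F x‖ := rfl
        rw [e] at this
        rw [this, eLpNorm_norm, ENNReal.toReal_mul]
        simp [abs_of_nonneg hη]
      have j2 : (eLpNorm (fun x : ℝ => 3 * B * C / N * (1 + x ^ 2)⁻¹) 2 volume).toReal = 3 * B * C / N * G := by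
        have := eLpNorm_const_smul (3 * B * C / N) (fun x : ℝ => (1 + x ^ 2)⁻¹) 2 (volume : Measure ℝ)
        have e : ((3 * B * C / N) • fun x : ℝ => (1 + x ^ 2)⁻¹) = fun x => 3 * B * C / N * (1 + x ^ 2)⁻¹ := rfl
        rw [e] at this
        rw [this, ENNReal.toReal_mul]
        have : 0 ≤ 3 * B * C / N := by positivity
        rw [toReal_enorm, Real.norm_of_nonneg this]
      exact congrArg₂ (· + ·) j1 j2
    have hJ := J_pos F hFne
    refine (mP_le z F hFne).trans ?_
    rw [div_le_iff₀ hJ]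
    refine hnorm.trans ?_
    rw [add_mul]
    refine add_le_add le_rfl ?_
    have hG0 : 0 ≤ G := ENNReal.toReal_nonneg
    have : 3 * B * C / N * G = 3 * B * C / N * G / c * c := by field_simp
    calc 3 * B * C / N * G = 3 * B * C / N * G / c * c := this
      _ ≤ _ := by gcongr
  have ht : Filter.Tendsto (fun N : ℝ => η + (3 * B * C / N) * G / c) Filter.atTop (nhds η) := by
    have := ((((tendsto_inv_atTop_zero (𝕜 := ℝ)).const_mul (3 * B * C)).mul_const G).div_const c).const_add η
    simpa [div_eq_mul_inv] using this
  exact ge_of_tendsto ht (Filter.eventually_atTop.2 ⟨1, key⟩)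
end Cub

namespace Cub
open scoped SchwartzMap FourierTransform ENNReal ContDiff

lemma gen2 (z : ℂ) (s s' : ℝ → ℂ) (η M X0 : ℝ) (hη : 0 ≤ η) (hM : 0 ≤ M) (hX0 : 0 ≤ X0)
    (hsm : ContDiff ℝ ∞ s)
    (hs : ∀ x, HasDerivAt s (s' x) x)
    (hE : ∀ x : ℝ, ‖s' x - s x ^ 2 - (z - I * x ^ 3)‖ ≤ η)
    (hsb : ∀ x, ‖s x‖ ≤ M * (1 + |x|) ^ 3)
    (hp : ∀ x, X0 ≤ x → 1 ≤ (s x).re) (hn : ∀ x, x ≤ -X0 → (s x).re ≤ -1) :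
    mP z ≤ η := by
  let S : ℝ → ℂ := fun x => ∫ t in (0:ℝ)..x, s t
  have hS : ∀ x, HasDerivAt S (s x) x := fun x =>
    intervalIntegral.integral_hasDerivAt_right (hsm.continuous.intervalIntegrable _ _)
      (hsm.continuous.stronglyMeasurableAtFilter _ _) hsm.continuous.continuousAt
  have hSsm : ContDiff ℝ ∞ S := by
    rw [contDiff_infty_iff_deriv]
    refine ⟨fun x => (hS x).differentiableAt, ?_⟩
    have : deriv S = s := funext fun x => (hS x).deriv
    rw [this]; exact hsm
  let f : ℝ → ℝ := fun x => (S x).re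
  have hf : ∀ x, HasDerivAt f ((s x).re) x := fun x => by
    have := Complex.reCLM.hasFDerivAt.comp_hasDerivAt x (hS x)
    exact this
  have hfc : Continuous f := continuous_iff_continuousAt.2 fun x => (hf x).continuousAt
  obtain ⟨A, hA⟩ := isCompact_Icc.exists_bound_of_continuousOn (s := Set.Icc (-X0) X0) hfc.continuousOn
  have hlow : ∀ x, |x| - (A + X0) ≤ f x := by
    intro x
    have a1 := abs_le.1 (hA X0 ⟨by linarith, le_rfl⟩)
    have a2 := abs_le.1 (hA (-X0) ⟨le_rfl, by linarith⟩)
    rcases le_total X0 x with h | h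
    · have := Convex.mul_sub_le_image_sub_of_le_deriv (convex_Ici X0) hfc.continuousOn
        (fun x _ => (hf x).differentiableAt.differentiableWithinAt) (C := 1)
        (fun y hy => by
          rw [(hf y).deriv]
          rw [interior_Ici] at hy
          exact hp y (le_of_lt hy)) X0 Set.self_mem_Ici x h h
      rw [abs_of_nonneg (hX0.trans h)]
      linarith [a1.1]
    · rcases le_total (-X0) x with h' | h'
      · have := abs_le.1 (hA x ⟨h', h⟩)
        have h2 : |x| ≤ X0 := abs_le.2 ⟨h', h⟩
        linarith [this.1]
      · have := Convex.image_sub_le_mul_sub_of_deriv_le (convex_Iic (-X0)) hfc.continuousOn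
          (fun x _ => (hf x).differentiableAt.differentiableWithinAt) (C := -1)
          (fun y hy => by
            rw [(hf y).deriv]
            rw [interior_Iic] at hy
            exact hn y (le_of_lt hy)) x h' (-X0) Set.self_mem_Iic h'
        rw [abs_of_nonpos (by linarith)]
        linarith [a2.1]
  have hu0 : ∀ x, ‖Complex.exp (-S x)‖ ≤ Real.exp (A + X0 + 1) * Real.exp (-(1 + |x|)) := by
    intro x
    rw [Complex.norm_exp, ← Real.exp_add]
    apply Real.exp_le_exp.2
    have := hlow x
    simp only [f] at this
    simp only [Complex.neg_re]
    linarith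
  have h5 : ∀ x : ℝ, (1 + |x|) ^ 3 * Real.exp (-(1 + |x|)) ≤ 120 * (1 + x ^ 2)⁻¹ := by
    intro x
    have h := Real.pow_div_factorial_le_exp (x := 1 + |x|) (by positivity) 5
    have h1 : (0:ℝ) < 1 + x ^ 2 := by positivity
    have h2 : 1 + x ^ 2 ≤ (1 + |x|) ^ 2 := by
      rw [← sq_abs x]; nlinarith [abs_nonneg x]
    rw [Real.exp_neg, ← div_eq_mul_inv, ← div_eq_mul_inv, div_le_div_iff₀ (Real.exp_pos _) h1]
    rw [div_le_iff₀ (by positivity)] at h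
    have h3 : ((Nat.factorial 5 : ℕ) : ℝ) = 120 := by norm_num [Nat.factorial]
    rw [h3] at h
    calc (1 + |x|) ^ 3 * (1 + x ^ 2) ≤ (1 + |x|) ^ 3 * (1 + |x|) ^ 2 := by gcongr
      _ = (1 + |x|) ^ 5 := by ring
      _ ≤ _ := by linarith
  have hone : ∀ x : ℝ, 1 ≤ (1 + |x|) ^ 3 := fun x => by
    apply one_le_pow₀; linarith [abs_nonneg x]
  set c := Real.exp (A + X0 + 1) with hc
  have hc0 : 0 < c := Real.exp_pos _
  refine gen z (fun x => Complex.exp (-S x)) s s' η ((M + 1) * c * 120) hη (by positivity)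
    (fun x => Complex.exp_ne_zero _) hSsm.neg.cexp ?_ hs hE ?_ ?_
  · intro x
    refine (hS x).neg.cexp.congr_deriv ?_
    simp only [Pi.neg_apply]
    ring
  · intro x
    calc ‖Complex.exp (-S x)‖ ≤ c * Real.exp (-(1 + |x|)) := hu0 x
      _ ≤ c * ((1 + |x|) ^ 3 * Real.exp (-(1 + |x|))) := by
        gcongr
        exact le_mul_of_one_le_left (Real.exp_pos _).le (hone x)
      _ ≤ c * (120 * (1 + x ^ 2)⁻¹) := mul_le_mul_of_nonneg_left (h5 x) hc0.le
      _ ≤ (M + 1) * (c * (120 * (1 + x ^ 2)⁻¹)) := le_mul_of_one_le_left (by positivity) (by linarith)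
      _ = _ := by ring
  · intro x
    calc ‖s x‖ * ‖Complex.exp (-S x)‖ ≤ (M * (1 + |x|) ^ 3) * (c * Real.exp (-(1 + |x|))) := by
          gcongr
          · exact hsb x
          · exact hu0 x
      _ = M * (c * ((1 + |x|) ^ 3 * Real.exp (-(1 + |x|)))) := by ring
      _ ≤ M * (c * (120 * (1 + x ^ 2)⁻¹)) := mul_le_mul_of_nonneg_left (mul_le_mul_of_nonneg_left (h5 x) hc0.le) hM
      _ ≤ (M + 1) * (c * (120 * (1 + x ^ 2)⁻¹)) := by gcongr; linarith
      _ = _ := by ring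
end Cub

namespace Cub
open scoped SchwartzMap FourierTransform ENNReal ContDiff

lemma bd {X t ρ : ℝ} (hX : 0 ≤ X) (ht : 0 ≤ t) (hρ : 0 ≤ ρ) (hρ1 : ρ ≤ 1) (h1 : t ≤ ρ ^ 6)
    (h2 : X ^ 6 * t ^ 7 ≤ ρ ^ 6) : t ^ 3 ≤ ρ ∧ X ^ 3 * t ^ 5 ≤ ρ ∧ X ^ 6 * t ^ 7 ≤ ρ ∧ X ^ 2 * t ^ 6 ≤ ρ ∧
      X ^ 5 * t ^ 8 ≤ ρ ∧ X ^ 8 * t ^ 10 ≤ ρ ∧ X ^ 4 * t ^ 5 ≤ 1 := by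
  obtain ⟨a, ha0, ha⟩ : ∃ a : ℝ, 0 ≤ a ∧ a ^ 6 = t := by
    refine ⟨t ^ ((1:ℝ)/6), by positivity, ?_⟩
    rw [← Real.rpow_natCast, ← Real.rpow_mul ht]; norm_num
  have haρ : a ≤ ρ := by
    rw [← ha] at h1
    exact (pow_le_pow_iff_left₀ ha0 hρ (by norm_num)).1 h1
  set b := X * a ^ 7 with hb
  have hb0 : 0 ≤ b := by positivity
  have hbρ : b ≤ ρ := by
    have : b ^ 6 ≤ ρ ^ 6 := by
      rw [← ha] at h2
      calc b ^ 6 = X ^ 6 * (a ^ 6) ^ 7 := by rw [hb]; ring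
        _ ≤ _ := h2
    exact (pow_le_pow_iff_left₀ hb0 hρ (by norm_num)).1 this
  have ha1 : a ≤ 1 := haρ.trans hρ1
  have hb1 : b ≤ 1 := hbρ.trans hρ1
  have pa : ∀ n, a ^ n ≤ 1 := fun n => pow_le_one₀ ha0 ha1
  have pb : ∀ n, b ^ (n + 1) ≤ ρ := fun n => by
    rw [pow_succ]
    calc b ^ n * b ≤ 1 * b := by gcongr; exact pow_le_one₀ hb0 hb1
      _ ≤ ρ := by rw [one_mul]; exact hbρ
  have pab : ∀ n m, b ^ (n + 1) * a ^ m ≤ ρ := fun n m => by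
    calc b ^ (n + 1) * a ^ m ≤ b ^ (n + 1) * 1 := by gcongr; exact pa m
      _ ≤ ρ := by rw [mul_one]; exact pb n
  rw [← ha]
  refine ⟨?_, ?_, ?_, ?_, ?_, ?_, ?_⟩
  · calc (a ^ 6) ^ 3 = a ^ 17 * a := by ring
      _ ≤ 1 * a := by gcongr; exact pa 17
      _ ≤ ρ := by rw [one_mul]; exact haρ
  · convert pab 2 9 using 1; rw [hb]; ring
  · convert pab 5 0 using 1; rw [hb]; ring
  · convert pab 1 22 using 1; rw [hb]; ring
  · convert pab 4 13 using 1; rw [hb]; ring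
  · convert pab 7 4 using 1; rw [hb]; ring
  · refine le_trans (le_of_eq ?_) ((pab 3 2).trans hρ1); rw [hb]; ring

lemma n6 {a b c d e f : ℂ} : ‖a + b + c + d + e + f‖ ≤ ‖a‖ + ‖b‖ + ‖c‖ + ‖d‖ + ‖e‖ + ‖f‖ := by
  refine (norm_add_le _ _).trans (add_le_add ?_ le_rfl)
  refine (norm_add_le _ _).trans (add_le_add ?_ le_rfl)
  refine (norm_add_le _ _).trans (add_le_add ?_ le_rfl)
  exact norm_add₃_le

set_option maxHeartbeats 1600000 in
lemma wkb (z : ℂ) (ρ : ℝ) (hρ : 0 < ρ) (hρ1 : ρ ≤ 1) (hre : 0 < z.re)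
    (h1 : ∀ x : ℝ, 1 ≤ ρ ^ 12 * ‖z - I * x ^ 3‖)
    (h2 : ∀ x : ℝ, |x| ^ 12 ≤ ρ ^ 12 * ‖z - I * x ^ 3‖ ^ 7) : mP z ≤ 30 * ρ := by
  let Q : ℝ → ℂ := fun x => z - I * x ^ 3
  have hQre : ∀ x, (Q x).re = z.re := by
    intro x
    simp only [Q]
    rw [← Complex.ofReal_pow]
    simp only [Complex.sub_re, Complex.mul_re, I_re, I_im, ofReal_re, ofReal_im]; ring
  have hQim : ∀ x, (Q x).im = z.im - x ^ 3 := by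
    intro x
    simp only [Q]
    rw [← Complex.ofReal_pow]
    simp only [Complex.sub_im, Complex.mul_im, I_re, I_im, ofReal_re, ofReal_im]; ring
  have hsl : ∀ x, Q x ∈ slitPlane := fun x => Or.inl (by rw [hQre]; exact hre)
  have hQ0 : ∀ x, Q x ≠ 0 := fun x => slitPlane_ne_zero (hsl x)
  have hQd : ∀ x : ℝ, HasDerivAt Q (-3 * I * x ^ 2) x := by
    intro x
    have := (((Complex.ofRealCLM.hasDerivAt (x := x)).pow 3).const_mul I).const_sub z
    refine this.congr_deriv ?_
    simp; ring
  have hQs : ContDiff ℝ ∞ Q := by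
    have : ContDiff ℝ ∞ (fun x : ℝ => (x : ℂ)) := Complex.ofRealCLM.contDiff
    exact contDiff_const.sub (contDiff_const.mul (this.pow 3))
  let v : ℝ → ℂ := fun x => Complex.exp (-(Complex.log (Q x)) / 2)
  have hQv : ∀ x, Q x * v x ^ 2 = 1 := by
    intro x
    simp only [v]
    nth_rewrite 1 [← Complex.exp_log (hQ0 x)]
    rw [← Complex.exp_nat_mul, ← Complex.exp_add]
    rw [show Complex.log (Q x) + ((2:ℕ):ℂ) * (-(Complex.log (Q x)) / 2) = 0 by push_cast; ring, Complex.exp_zero]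
  have hvd : ∀ x : ℝ, HasDerivAt v (3 / 2 * I * x ^ 2 * v x ^ 3) x := by
    intro x
    have := (((hQd x).clog_real (hsl x)).neg.div_const 2).cexp
    refine this.congr_deriv ?_
    have e : -3 * I * (x:ℂ) ^ 2 / Q x = -3 * I * (x:ℂ) ^ 2 * v x ^ 2 := by
      rw [div_eq_iff (hQ0 x)]
      linear_combination (3 * I * (x:ℂ) ^ 2) * hQv x
    rw [e]
    show v x * _ = _
    ring
  have hvs : ContDiff ℝ ∞ v := by
    have : ContDiff ℝ ∞ (fun x => Complex.log (Q x)) := by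
      rw [contDiff_iff_contDiffAt]
      intro x
      exact ((contDiffAt_log (hsl x)).restrict_scalars ℝ).comp x hQs.contDiffAt
    exact (this.neg.div_const 2).cexp
  let r : ℝ → ℂ := fun x => -(3 / 4 * I * (x:ℂ) ^ 2 * v x ^ 2) - 3 / 4 * x * v x ^ 3 - 45 / 32 * I * (x:ℂ) ^ 4 * v x ^ 5
  let s : ℝ → ℂ := fun x => I * (Q x * v x) - 3 / 4 * I * ((x:ℂ) ^ 2 * v x ^ 2) - 3 / 4 * (x * v x ^ 3)
    - 45 / 32 * I * ((x:ℂ) ^ 4 * v x ^ 5)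
  have hxs : ContDiff ℝ ∞ (fun x : ℝ => (x : ℂ)) := Complex.ofRealCLM.contDiff
  have hss : ContDiff ℝ ∞ s := by
    exact (((contDiff_const.mul (hQs.mul hvs)).sub (contDiff_const.mul ((hxs.pow 2).mul (hvs.pow 2)))).sub
      (contDiff_const.mul (hxs.mul (hvs.pow 3)))).sub (contDiff_const.mul ((hxs.pow 4).mul (hvs.pow 5)))
  let v' : ℝ → ℂ := fun x => 3 / 2 * I * x ^ 2 * v x ^ 3
  let s' : ℝ → ℂ := fun x => I * ((-3 * I * x ^ 2) * v x + Q x * v' x)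
    - 3 / 4 * I * (2 * x * v x ^ 2 + x ^ 2 * (2 * v x * v' x)) - 3 / 4 * (v x ^ 3 + x * (3 * v x ^ 2 * v' x))
    - 45 / 32 * I * (4 * x ^ 3 * v x ^ 5 + x ^ 4 * (5 * v x ^ 4 * v' x))
  have hsd : ∀ x, HasDerivAt s (s' x) x := by
    intro x
    have hx := Complex.ofRealCLM.hasDerivAt (x := x)
    have hv := hvd x
    have := (((((hQd x).mul hv).const_mul I).sub (((hx.pow 2).mul (hv.pow 2)).const_mul (3 / 4 * I))).sub
      ((hx.mul (hv.pow 3)).const_mul (3 / 4))).sub (((hx.pow 4).mul (hv.pow 5)).const_mul (45 / 32 * I))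
    refine this.congr_deriv ?_
    simp [s', v']
  have ht2 : ∀ x, ‖Q x‖ * ‖v x‖ ^ 2 = 1 := fun x => by
    rw [← norm_pow, ← norm_mul, hQv, norm_one]
  have ht6 : ∀ x, ‖v x‖ ≤ ρ ^ 6 := fun x => by
    have h := h1 x
    have h' : ‖v x‖ ^ 2 ≤ (ρ ^ 6) ^ 2 := by
      calc ‖v x‖ ^ 2 = 1 * ‖v x‖ ^ 2 := by ring
        _ ≤ (ρ ^ 12 * ‖Q x‖) * ‖v x‖ ^ 2 := by gcongr
        _ = (ρ ^ 6) ^ 2 * (‖Q x‖ * ‖v x‖ ^ 2) := by ring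
        _ = _ := by rw [ht2, mul_one]
    exact (sq_le_sq₀ (norm_nonneg _) (by positivity)).1 h'
  have ht7 : ∀ x, |x| ^ 6 * ‖v x‖ ^ 7 ≤ ρ ^ 6 := fun x => by
    have h := h2 x
    have h' : (|x| ^ 6 * ‖v x‖ ^ 7) ^ 2 ≤ (ρ ^ 6) ^ 2 := by
      calc (|x| ^ 6 * ‖v x‖ ^ 7) ^ 2 = |x| ^ 12 * ‖v x‖ ^ 14 := by ring
        _ ≤ (ρ ^ 12 * ‖Q x‖ ^ 7) * ‖v x‖ ^ 14 := by gcongr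
        _ = (ρ ^ 6) ^ 2 * (‖Q x‖ * ‖v x‖ ^ 2) ^ 7 := by ring
        _ = _ := by rw [ht2, one_pow, mul_one]
    exact (sq_le_sq₀ (by positivity) (by positivity)).1 h'
  have hbd := fun x : ℝ => bd (abs_nonneg x) (norm_nonneg (v x)) hρ.le hρ1 (ht6 x) (ht7 x)
  have ht1 : ∀ x, ‖v x‖ ≤ 1 := fun x => (ht6 x).trans (pow_le_one₀ hρ.le hρ1)
  have hE : ∀ x : ℝ, ‖s' x - s x ^ 2 - (z - I * x ^ 3)‖ ≤ 30 * ρ := by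
    intro x
    have e : s' x - s x ^ 2 - (z - I * x ^ 3) = (-3/4)*v x^3 + (-9/16)*((x:ℂ)^2*v x^6) + (405/32)*((x:ℂ)^6*v x^7)
        + (2025/1024)*((x:ℂ)^8*v x^10) + (-81/8)*I*((x:ℂ)^3*v x^5) + (-135/64)*I*((x:ℂ)^5*v x^8) := by
      change s' x - s x ^ 2 - Q x = _
      have hh := hQv x
      simp only [s', s, v']
      generalize v x = v at *
      generalize Q x = Q at *
      linear_combination ((1)*Q^1 + (-3)*(x:ℂ)^2*v^1 + (-45/16)*(x:ℂ)^4*v^4 + (3/2)*I^1*(x:ℂ)^1*v^2) * hh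
        + ((-1)*v^2*Q^2 + (-3)*(x:ℂ)^2*v^1 + (3)*(x:ℂ)^2*v^3*Q^1 + (-45/16)*(x:ℂ)^4*v^4 + (45/16)*(x:ℂ)^4*v^6*Q^1 + (-405/32)*(x:ℂ)^6*v^7 + (-2025/1024)*(x:ℂ)^8*v^10) * I_sq
    rw [e]
    obtain ⟨q1, q2, q3, q4, q5, q6, -⟩ := hbd x
    refine n6.trans ?_
    simp only [norm_mul, norm_pow, norm_div, norm_neg, Complex.norm_ofNat, Complex.norm_I,
      Complex.norm_real, Real.norm_eq_abs]
    linarith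
  have hr : ∀ x, ‖s x - I * (Q x * v x)‖ ≤ 3 / 4 * (|x| ^ 2 * ‖v x‖ ^ 2) + 3 / 4 * (|x| * ‖v x‖ ^ 3)
      + 45 / 32 * (|x| ^ 4 * ‖v x‖ ^ 5) := by
    intro x
    have e : s x - I * (Q x * v x) = -(3 / 4 * I * ((x:ℂ) ^ 2 * v x ^ 2)) + -(3 / 4 * (x * v x ^ 3))
      + -(45 / 32 * I * ((x:ℂ) ^ 4 * v x ^ 5)) := by simp only [s]; ring
    rw [e]
    refine norm_add₃_le.trans (le_of_eq ?_)
    simp only [norm_mul, norm_pow, norm_div, norm_neg, Complex.norm_ofNat, Complex.norm_I,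
      Complex.norm_real, Real.norm_eq_abs]
    ring
  have hQn : ∀ x, ‖Q x‖ ≤ ‖z‖ + |x| ^ 3 := by
    intro x
    refine (norm_sub_le _ _).trans (le_of_eq ?_)
    simp
  have hQl : ∀ x, |x| ^ 3 - ‖z‖ ≤ ‖Q x‖ := by
    intro x
    have := norm_sub_norm_le (I * (x:ℂ) ^ 3) z
    rw [norm_sub_rev] at this
    refine le_trans (le_of_eq ?_) this
    simp
  -- far behaviour
  have far : ∀ x, 2 * ‖z‖ + 100 ≤ |x| → |(s x).re + (Q x * v x).im| ≤ 3 ∧ 16 ≤ (Q x * v x).im ^ 2 ∧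
      2 * (Q x * v x).re * (Q x * v x).im = z.im - x ^ 3 ∧ 0 < (Q x * v x).re ∧ ‖z‖ < |x| ^ 3 := by
    intro x hx
    have hz0 := norm_nonneg z
    set X := |x| with hX
    have hX100 : 100 ≤ X := by linarith
    have hX2 : X ≤ X ^ 2 := by nlinarith
    have hX3 : 100 * X ^ 2 ≤ X ^ 3 := by nlinarith [sq_nonneg X]
    have hq := hQl x
    have hq2 : X ^ 2 ≤ ‖Q x‖ := by nlinarith
    have hq3 : 2 * ‖z‖ + 100 ≤ ‖Q x‖ := by linarith
    have hv0 := norm_nonneg (v x)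
    refine ⟨?_, ?_, ?_, ?_, by nlinarith⟩
    · have : (s x).re + (Q x * v x).im = (s x - I * (Q x * v x)).re := by
        rw [Complex.sub_re (s x), Complex.I_mul_re]; ring
      rw [this]
      refine (Complex.abs_re_le_norm _).trans ((hr x).trans ?_)
      have b1 : X ^ 2 * ‖v x‖ ^ 2 ≤ 1 := by rw [← ht2 x]; gcongr
      have b2 : X * ‖v x‖ ^ 3 ≤ 1 := by
        calc X * ‖v x‖ ^ 3 = X * ‖v x‖ ^ 2 * ‖v x‖ := by ring
          _ ≤ X ^ 2 * ‖v x‖ ^ 2 * 1 := by gcongr; exact ht1 x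
          _ ≤ 1 := by linarith
      have b3 := (hbd x).2.2.2.2.2.2
      linarith
    · have hw : (Q x * v x) ^ 2 = Q x := by linear_combination Q x * hQv x
      have n1 : (Q x * v x).re ^ 2 + (Q x * v x).im ^ 2 = ‖Q x‖ := by
        nth_rewrite 3 [← hw]
        rw [norm_pow, ← Complex.normSq_eq_norm_sq, Complex.normSq_apply]; ring
      have n2 : (Q x * v x).re ^ 2 - (Q x * v x).im ^ 2 = z.re := by
        rw [← hQre x]
        nth_rewrite 3 [← hw]
        rw [sq (Q x * v x), Complex.mul_re (Q x * v x)]; ring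
      have n3 := (le_abs_self _).trans (Complex.abs_re_le_norm z)
      linarith
    · have hw : (Q x * v x) ^ 2 = Q x := by linear_combination Q x * hQv x
      rw [← hQim x]
      nth_rewrite 3 [← hw]
      rw [sq (Q x * v x), Complex.mul_im (Q x * v x)]; ring
    · have : Q x * v x = Complex.exp (Complex.log (Q x) / 2) := by
        simp only [v]
        nth_rewrite 1 [← Complex.exp_log (hQ0 x)]
        rw [← Complex.exp_add]; congr 1; ring
      rw [this, Complex.exp_re]
      apply mul_pos (Real.exp_pos _)
      have i1 : (Complex.log (Q x) / 2).im = (Q x).arg / 2 := by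
        have : Complex.log (Q x) / 2 = Complex.log (Q x) / ((2:ℝ):ℂ) := by norm_num
        rw [this, Complex.div_ofReal_im, Complex.log_im]
      rw [i1]
      have a1 := Complex.arg_le_pi (Q x)
      have a2 := Complex.neg_pi_lt_arg (Q x)
      have a3 := (Complex.mem_slitPlane_iff_arg.1 (hsl x)).1
      have a4 : (Q x).arg < Real.pi := lt_of_le_of_ne a1 a3
      exact Real.cos_pos_of_mem_Ioo ⟨by linarith, by linarith⟩
  have hz0 := norm_nonneg z
  have hzi := abs_le.1 (Complex.abs_im_le_norm z)
  refine gen2 z s s' (30 * ρ) (‖z‖ + 5) (2 * ‖z‖ + 100) (by positivity) (by positivity) (by positivity)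
    hss hsd hE ?_ ?_ ?_
  · intro x
    have hX0 := abs_nonneg x
    set X := |x| with hX
    have hv0 := norm_nonneg (v x)
    have e := hr x
    have e1 : ‖s x‖ ≤ ‖s x - I * (Q x * v x)‖ + ‖I * (Q x * v x)‖ := by
      have := norm_add_le (s x - I * (Q x * v x)) (I * (Q x * v x))
      simpa using this
    have e2 : ‖I * (Q x * v x)‖ ≤ ‖z‖ + X ^ 3 := by
      rw [norm_mul, norm_mul, Complex.norm_I, one_mul]
      calc ‖Q x‖ * ‖v x‖ ≤ ‖Q x‖ * 1 := by gcongr; exact ht1 x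
        _ ≤ _ := by rw [mul_one]; exact hQn x
    have e3 : X ^ 2 * ‖v x‖ ^ 2 ≤ X ^ 2 := mul_le_of_le_one_right (by positivity) (pow_le_one₀ hv0 (ht1 x))
    have e4 : X * ‖v x‖ ^ 3 ≤ X := mul_le_of_le_one_right (by positivity) (pow_le_one₀ hv0 (ht1 x))
    have e5 := (hbd x).2.2.2.2.2.2
    have e6 : (1 + X) ^ 3 = 1 + 3 * X + 3 * X ^ 2 + X ^ 3 := by ring
    have e7 : 1 ≤ (1 + X) ^ 3 := one_le_pow₀ (by linarith)
    have e8 : ‖z‖ ≤ ‖z‖ * (1 + X) ^ 3 := le_mul_of_one_le_right hz0 e7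
    have e9 : (‖z‖ + 5) * (1 + X) ^ 3 = ‖z‖ * (1 + X) ^ 3 + 5 * (1 + 3 * X + 3 * X ^ 2 + X ^ 3) := by ring
    rw [e9]
    have : 0 ≤ X ^ 2 := by positivity
    have : 0 ≤ X ^ 3 := by positivity
    linarith
  · intro x hx
    have hx0 : 0 ≤ x := by linarith
    obtain ⟨f1, f2, f3, f4, f5⟩ := far x (by rw [abs_of_nonneg hx0]; exact hx)
    rw [abs_of_nonneg hx0] at f5
    have f6 := abs_le.1 f1
    have f7 : (Q x * v x).im < 0 := by
      by_contra h
      push Not at h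
      have := mul_nonneg (mul_nonneg two_pos.le f4.le) h
      linarith [hzi.2]
    have f8 : (Q x * v x).im ≤ -4 := by nlinarith
    linarith [f6.1]
  · intro x hx
    have hx0 : x ≤ 0 := by linarith
    obtain ⟨f1, f2, f3, f4, f5⟩ := far x (by rw [abs_of_nonpos hx0]; linarith)
    rw [abs_of_nonpos hx0] at f5
    have f6 := abs_le.1 f1
    have f5' : (-x) ^ 3 = - x ^ 3 := by ring
    have f7 : 0 < (Q x * v x).im := by
      by_contra h
      push Not at h
      have := mul_nonpos_of_nonneg_of_nonpos (mul_nonneg two_pos.le f4.le) h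
      linarith [hzi.1]
    have f8 : 4 ≤ (Q x * v x).im := by nlinarith
    linarith [f6.2]
end Cub

namespace Cub
open scoped SchwartzMap FourierTransform ENNReal ContDiff

lemma partB2 (ε : ℝ) (hε : 0 < ε) : ∀ᶠ y : ℝ in Filter.atTop, ∀ z : ℂ, z.im = y →
    y ^ ((3:ℝ)/5) ≤ z.re → mP z < ε := by
  set ρ := min 1 (ε / 60) with hρdef
  have hρ : 0 < ρ := lt_min one_pos (by positivity)
  have hρ1 : ρ ≤ 1 := min_le_left _ _
  have hρε : ρ ≤ ε / 60 := min_le_right _ _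
  have hρ12 : 0 < ρ ^ 12 := by positivity
  have hρ12' : ρ ^ 12 ≤ 1 := pow_le_one₀ hρ.le hρ1
  filter_upwards [(tendsto_rpow_atTop (y := (1/5:ℝ)) (by norm_num)).eventually_ge_atTop (16 / ρ ^ 12),
    Filter.eventually_gt_atTop 0] with y hy hy0 z hz hre
  set g := y ^ (1/5:ℝ) with hg
  have g5 : g ^ 5 = y := by
    rw [hg, ← Real.rpow_natCast, ← Real.rpow_mul hy0.le]; norm_num
  have g3 : y ^ ((3:ℝ)/5) = g ^ 3 := by
    rw [hg, ← Real.rpow_natCast, ← Real.rpow_mul hy0.le]; norm_num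
  rw [g3] at hre
  rw [div_le_iff₀ hρ12] at hy
  have hg1 : 1 ≤ g := by nlinarith [Real.rpow_nonneg hy0.le (1/5:ℝ)]
  have hg3 : g ≤ g ^ 3 := le_self_pow₀ hg1 (by norm_num)
  have hQre : ∀ x : ℝ, (z - I * x ^ 3).re = z.re := by
    intro x
    rw [← Complex.ofReal_pow]
    simp only [Complex.sub_re, Complex.mul_re, I_re, I_im, ofReal_re, ofReal_im]; ring
  have hQim : ∀ x : ℝ, (z - I * x ^ 3).im = z.im - x ^ 3 := by
    intro x
    rw [← Complex.ofReal_pow]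
    simp only [Complex.sub_im, Complex.mul_im, I_re, I_im, ofReal_re, ofReal_im]; ring
  have hQ : ∀ x : ℝ, g ^ 3 ≤ ‖z - I * x ^ 3‖ := by
    intro x
    have := (le_abs_self _).trans (Complex.abs_re_le_norm (z - I * x ^ 3))
    rw [hQre] at this
    linarith
  have hQg : ∀ x : ℝ, g ≤ ‖z - I * x ^ 3‖ := fun x => hg3.trans (hQ x)
  have := wkb z ρ hρ hρ1 (by have : 0 < g ^ 3 := by positivity
                             linarith) (fun x => ?_) (fun x => ?_)
  · linarith
  · have := mul_le_mul_of_nonneg_left (hQg x) hρ12.le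
    linarith
  · have hq := hQ x
    have hqg := hQg x
    set q := ‖z - I * x ^ 3‖ with hqdef
    have hq1 : 1 ≤ q := hg1.trans hqg
    have e12 : |x| ^ 12 = (|x| ^ 3) ^ 4 := by ring
    rcases le_total (|x| ^ 3) (2 * y) with h | h
    · calc |x| ^ 12 = (|x| ^ 3) ^ 4 := e12
        _ ≤ (2 * y) ^ 4 := by gcongr
        _ = 16 * g ^ 20 := by rw [← g5]; ring
        _ ≤ (g * ρ ^ 12) * g ^ 20 := by gcongr
        _ = ρ ^ 12 * (g ^ 3) ^ 7 := by ring
        _ ≤ _ := by gcongr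
    · have h3 : |x| ^ 3 ≤ 2 * q := by
        have h4 := Complex.abs_im_le_norm (z - I * x ^ 3)
        rw [hQim, hz] at h4
        have h5 : |x ^ 3| - |y| ≤ |y - x ^ 3| := by
          rw [abs_sub_comm]; exact abs_sub_abs_le_abs_sub _ _
        rw [abs_pow, abs_of_pos hy0] at h5
        linarith
      calc |x| ^ 12 = (|x| ^ 3) ^ 4 := e12
        _ ≤ (2 * q) ^ 4 := by gcongr
        _ = 16 * q ^ 4 := by ring
        _ ≤ (g * ρ ^ 12) * q ^ 4 := by gcongr
        _ ≤ (q ^ 3 * ρ ^ 12) * q ^ 4 := by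
          gcongr
          exact hqg.trans (le_self_pow₀ hq1 (by norm_num))
        _ = _ := by ring

lemma partC (ε δ : ℝ) (hε : 0 < ε) (hδ : 0 < δ) : ∀ᶠ y : ℝ in Filter.atTop,
    |((9:ℝ)/4) ^ ((2:ℝ)/3) * (Real.log (y ^ ((4:ℝ)/9) / ε)) ^ ((2:ℝ)/3) - (Real.log y) ^ ((2:ℝ)/3)|
      ≤ δ * (Real.log y) ^ ((2:ℝ)/3) := by
  set c := 9 / 4 * Real.log ε with hc
  have t0 : Filter.Tendsto (fun y : ℝ => 1 - c * (Real.log y)⁻¹) Filter.atTop (nhds 1) := by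
    have := ((tendsto_inv_atTop_zero.comp Real.tendsto_log_atTop).const_mul c).const_sub 1
    simpa using this
  have t1 : Filter.Tendsto (fun y : ℝ => (1 - c * (Real.log y)⁻¹) ^ ((2:ℝ)/3)) Filter.atTop (nhds 1) := by
    have := t0.rpow_const (p := (2:ℝ)/3) (Or.inl one_ne_zero)
    simpa using this
  have t2 := t1.eventually (Metric.ball_mem_nhds 1 hδ)
  have t3 := t0.eventually (lt_mem_nhds one_pos)
  filter_upwards [t2, t3, Filter.eventually_gt_atTop 1] with y h2 h3 hy
  have hy0 : 0 < y := by linarith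
  have hl : 0 < Real.log y := Real.log_pos hy
  have e1 : Real.log (y ^ ((4:ℝ)/9) / ε) = 4 / 9 * (Real.log y * (1 - c * (Real.log y)⁻¹)) := by
    rw [Real.log_div (by positivity) hε.ne', Real.log_rpow hy0, hc]
    field_simp
  have e2 : ((9:ℝ)/4) ^ ((2:ℝ)/3) * (Real.log (y ^ ((4:ℝ)/9) / ε)) ^ ((2:ℝ)/3) =
      (Real.log y) ^ ((2:ℝ)/3) * (1 - c * (Real.log y)⁻¹) ^ ((2:ℝ)/3) := by
    rw [e1, ← Real.mul_rpow (by norm_num) (by positivity), ← Real.mul_rpow hl.le h3.le]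
    congr 1; ring
  rw [e2]
  have e3 : ∀ a b : ℝ, a * b - a = (b - 1) * a := fun a b => by ring
  rw [e3, abs_mul, abs_of_nonneg (Real.rpow_nonneg hl.le _)]
  rw [Real.dist_eq] at h2
  gcongr

lemma final : 
    ∃ ε₀ : ℝ, 0 < ε₀ ∧ ∀ ε ∈ Set.Ioo (0:ℝ) ε₀, ∀ δ : ℝ, 0 < δ →
      ∃ R : ℝ, 0 < R ∧ ∀ z : ℂ, R ≤ z.im → 0 ≤ z.re → mP z = ε →
        |z.re - ((9:ℝ)/4) ^ ((2:ℝ)/3) * z.im ^ ((4:ℝ)/9)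
            * (Real.log (z.im ^ ((4:ℝ)/9) / ε)) ^ ((2:ℝ)/3)|
          ≤ δ * z.im ^ ((4:ℝ)/9) * (Real.log z.im) ^ ((2:ℝ)/3) := by
  refine ⟨1, one_pos, ?_⟩
  intro ε hε δ hδ
  have hε0 := hε.1
  have hd0 : 0 < min (δ / 2) (1 / 2) := lt_min (by linarith) (by norm_num)
  have hd1 : min (δ / 2) (1 / 2) < 1 := lt_of_le_of_lt (min_le_right _ _) (by norm_num)
  have A := partA (min (δ / 2) (1 / 2)) ε hd0 hd1 hε0
  have B1 := partB1 (δ / 2) ε (by linarith) hε0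
  have B2 := partB2 ε hε0
  have C := partC ε (δ / 2) hε0 (by linarith)
  obtain ⟨R, hR⟩ := Filter.eventually_atTop.1 (A.and (B1.and (B2.and C)))
  refine ⟨max R 1, by positivity, ?_⟩
  intro z hz hre hm
  obtain ⟨a, b1, b2, c⟩ := hR z.im ((le_max_left _ _).trans hz)
  have hy1 : 1 ≤ z.im := (le_max_right _ _).trans hz
  have hl : 0 ≤ Real.log z.im := Real.log_nonneg hy1
  have hL0 : 0 ≤ Lam z.im := by unfold Lam; positivity
  have low : (1 - δ / 2) * Lam z.im ≤ z.re := by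
    by_contra h
    push Not at h
    have h' : z.re ≤ (1 - min (δ / 2) (1 / 2)) * Lam z.im := by
      refine h.le.trans ?_
      gcongr
      exact min_le_left _ _
    have := a z rfl hre h' (by rw [hm]; exact hε0.ne')
    linarith
  have up : z.re ≤ (1 + δ / 2) * Lam z.im := by
    by_contra h
    push Not at h
    rcases le_total z.re (z.im ^ ((3:ℝ)/5)) with h' | h'
    · have := b1 z rfl h.le h'
      linarith
    · have := b2 z rfl h'
      linarith
  have hyp : 0 ≤ z.im ^ ((4:ℝ)/9) := by positivity
  have c' := mul_le_mul_of_nonneg_left c hyp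
  have e : Lam z.im = z.im ^ ((4:ℝ)/9) * (Real.log z.im) ^ ((2:ℝ)/3) := rfl
  rw [← abs_of_nonneg hyp, ← abs_mul, abs_of_nonneg hyp] at c'
  rw [abs_le] at c' ⊢
  constructor <;> nlinarith [c'.1, c'.2]
end Cub

/-- Asymptotics of the level lines of the resolvent norm of the cubic operator
`𝒫 = Dₓ² + ix³` above the real axis: on the level line `‖(𝒫 − z)^{-1}‖ = 1/ε`,
`Re z = (9/4)^{2/3}(Im z)^{4/9}(ln((Im z)^{4/9}/ε))^{2/3}(1 + o(1))` as `Im z → ∞`. -/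
theorem stmt_10 :
    ∃ ε₀ : ℝ, 0 < ε₀ ∧ ∀ ε ∈ Set.Ioo (0:ℝ) ε₀, ∀ δ : ℝ, 0 < δ →
      ∃ R : ℝ, 0 < R ∧ ∀ z : ℂ, R ≤ z.im → 0 ≤ z.re → mP z = ε →
        |z.re - ((9:ℝ)/4) ^ ((2:ℝ)/3) * z.im ^ ((4:ℝ)/9)
            * (Real.log (z.im ^ ((4:ℝ)/9) / ε)) ^ ((2:ℝ)/3)|
          ≤ δ * z.im ^ ((4:ℝ)/9) * (Real.log z.im) ^ ((2:ℝ)/3) := by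
  exact Cub.final
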